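/- For every positive integer n, cr(K_{1,1,3,n}) = Z(5,n) + ⌊3n/2⌋. -/

import Mathlib

open SimpleGraph

variable {V : Type*}

/-- A drawing of a simple graph in the plane: an injective placement of the
vertices in `ℝ²` together with, for each edge, a continuous arc joining the
positions of its endpoints (parametrised compatibly in both directions),
such that no arc passes through the position of a vertex other than its
endpoints. -/
structure Drawing (G : SimpleGraph V) where
  pos : V → ℝ × ℝ
  pos_inj : Function.Injective pos
  arc : V → V → ℝ → ℝ × ℝ
  arc_cont : ∀ ⦃a b⦄, G.Adj a b → ContinuousOn (arc a b) (Set.Icc 0 1)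
  arc_zero : ∀ ⦃a b⦄, G.Adj a b → arc a b 0 = pos a
  arc_one : ∀ ⦃a b⦄, G.Adj a b → arc a b 1 = pos b
  arc_symm : ∀ ⦃a b⦄, G.Adj a b → ∀ t, arc b a t = arc a b (1 - t)
  arc_avoid : ∀ ⦃a b⦄, G.Adj a b → ∀ c, c ≠ a → c ≠ b →
      pos c ∉ arc a b '' Set.Icc 0 1

namespace Drawing

variable {G : SimpleGraph V} (D : Drawing G)

/-- The set of points of the plane used by the edge `e`. -/
def edgePoints (e : Sym2 V) : Set (ℝ × ℝ) :=
  {p | ∃ a b, e = s(a, b) ∧ G.Adj a b ∧ p ∈ D.arc a b '' Set.Icc 0 1}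

/-- The positions of the endpoints of an edge. -/
def ends (e : Sym2 V) : Set (ℝ × ℝ) := {p | ∃ a ∈ e, p = D.pos a}

/-- `p` is a crossing of the (distinct) edges `e` and `f` in the drawing `D`:
a common point of the two edges other than an endpoint. -/
def IsCrossing (e f : Sym2 V) (p : ℝ × ℝ) : Prop :=
  e ∈ G.edgeSet ∧ f ∈ G.edgeSet ∧ e ≠ f ∧
    p ∈ D.edgePoints e ∧ p ∈ D.edgePoints f ∧ p ∉ D.ends e ∧ p ∉ D.ends f

/-- The crossings between an edge of `A` and an edge of `B`: a crossing is
recorded as a point of the plane together with the unordered pair of edges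
crossing there. -/
def crossings (A B : Set (Sym2 V)) : Set ((ℝ × ℝ) × Sym2 (Sym2 V)) :=
  {q | ∃ e f, q.2 = s(e, f) ∧ e ∈ A ∧ f ∈ B ∧ D.IsCrossing e f q.1}

/-- `cr_D(A, B)`: the number of crossings between an edge of `A` and an
edge of `B`. -/
noncomputable def crBetween (A B : Set (Sym2 V)) : ℕ := Nat.card (D.crossings A B)

/-- `cr(D)`: the total number of crossings of the drawing `D`. -/
noncomputable def crNum : ℕ := D.crBetween G.edgeSet G.edgeSet

/-- A good drawing: no edge crosses itself (each arc is a simple arc),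
no two adjacent edges cross, no two edges cross more than once, and no three
edges cross at a common point. -/
structure IsGood : Prop where
  arc_inj : ∀ ⦃a b⦄, G.Adj a b → Set.InjOn (D.arc a b) (Set.Icc 0 1)
  adj_no_cross : ∀ e f : Sym2 V, (∃ a, a ∈ e ∧ a ∈ f) → ∀ p, ¬ D.IsCrossing e f p
  cross_once : ∀ e f : Sym2 V, {p | D.IsCrossing e f p}.Subsingleton
  no_triple : ∀ p, ∀ e f g : Sym2 V, e ≠ f → e ≠ g → f ≠ g →
      ¬ (D.IsCrossing e f p ∧ D.IsCrossing f g p ∧ D.IsCrossing e g p)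

end Drawing

/-- The crossing number of a graph: the minimum number of crossings among
all good drawings of `G` in the plane. -/
noncomputable def crossingNumber (G : SimpleGraph V) : ℕ :=
  sInf {n | ∃ D : Drawing G, D.IsGood ∧ D.crNum = n}

/-- The Zarankiewicz function `Z(m,n) = ⌊m/2⌋⌊(m-1)/2⌋⌊n/2⌋⌊(n-1)/2⌋`. -/
def Z (m n : ℕ) : ℕ := m / 2 * ((m - 1) / 2) * (n / 2) * ((n - 1) / 2)

/-- The complete bipartite graph `K_{a,b}`. -/
abbrev bipK (a b : ℕ) : SimpleGraph (Fin a ⊕ Fin b) :=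
  completeBipartiteGraph (Fin a) (Fin b)

/-- The complete tripartite graph `K_{a,b,c}`. -/
abbrev triK (a b c : ℕ) : SimpleGraph (Σ i : Fin 3, ![Fin a, Fin b, Fin c] i) :=
  completeMultipartiteGraph ![Fin a, Fin b, Fin c]

/-- The complete 4-partite graph `K_{a,b,c,d}`. -/
abbrev quadK (a b c d : ℕ) : SimpleGraph (Σ i : Fin 4, ![Fin a, Fin b, Fin c, Fin d] i) :=
  completeMultipartiteGraph ![Fin a, Fin b, Fin c, Fin d]

/-- `E(V₁, V₂)`: the set of pairs `{v₁, v₂}` with `v₁ ∈ V₁` and `v₂ ∈ V₂`. -/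
def pairEdges {α : Type*} (V₁ V₂ : Set α) : Set (Sym2 α) :=
  {e | ∃ a ∈ V₁, ∃ b ∈ V₂, e = s(a, b)}

namespace CrK


/-- xor-linear combination of columns -/
def lin : List ℕ → List Bool → ℕ
  | c :: cs, b :: bs => (bif b then c else 0) ^^^ lin cs bs
  | _, _ => 0

/-- weight -/
def wt : List Bool → ℕ
  | [] => 0
  | b :: bs => b.toNat + wt bs

/-- checks `P` on all low-weight combinations of the columns -/
def chk (P : ℕ → ℕ → Bool) : List ℕ → ℕ → ℕ → ℕ → Bool
  | [], _, w, s => P s w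
  | _ :: cs, 0, w, s => chk P cs 0 w s
  | c :: cs, (B + 1), w, s => chk P cs (B + 1) w s && chk P cs B (w + 1) (s ^^^ c)

theorem chk_sound (P : ℕ → ℕ → Bool) : ∀ (cs : List ℕ) (B w s : ℕ), chk P cs B w s = true →
    ∀ bs : List Bool, bs.length = cs.length → wt bs ≤ B → P (s ^^^ lin cs bs) (w + wt bs) = true
  | [], B, w, s, h, [], _, _ => by simpa [chk, lin, wt] using h
  | c :: cs, 0, w, s, h, b :: bs, hl, hw => by
    cases b
    · have := chk_sound P cs 0 w s (by simpa [chk] using h) bs (by simpa using hl)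
        (by simpa [wt] using hw)
      simpa [lin, wt] using this
    · simp [wt] at hw
  | c :: cs, B + 1, w, s, h, b :: bs, hl, hw => by
    simp only [chk, Bool.and_eq_true] at h
    cases b
    · have := chk_sound P cs (B + 1) w s h.1 bs (by simpa using hl)
        (by simpa [wt] using hw)
      simpa [lin, wt] using this
    · have := chk_sound P cs B (w + 1) (s ^^^ c) h.2 bs (by simpa using hl)
        (by simp [wt] at hw; omega)
      simpa [lin, wt, Nat.xor_assoc, add_assoc] using this

/-- bit `r` of `lin` -/
def linb (r : ℕ) : List ℕ → List Bool → Bool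
  | c :: cs, b :: bs => (c.testBit r && b) ^^ linb r cs bs
  | _, _ => false

theorem lin_testBit (r : ℕ) : ∀ cs bs, (lin cs bs).testBit r = linb r cs bs
  | [], _ => by simp [lin, linb]
  | _ :: _, [] => by simp [lin, linb]
  | c :: cs, b :: bs => by
    simp only [lin, linb, Nat.testBit_xor, lin_testBit r cs bs]
    cases b <;> simp

def offd : List (ℕ × ℕ) := [(0,1),(0,2),(0,3),(0,4),(1,0),(1,2),(1,3),(1,4),(2,0),(2,1),(2,3),(2,4),
  (3,0),(3,1),(3,2),(3,4),(4,0),(4,1),(4,2),(4,3)]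
/-- `(a, (b, c))`: vertex `a` and an edge `bc` of `K_{1,1,3}` avoiding it -/
def yent : List (ℕ × ℕ × ℕ) := [(0,1,2),(0,1,3),(0,1,4),(1,0,2),(1,0,3),(1,0,4),
  (2,0,1),(2,0,3),(2,0,4),(2,1,3),(2,1,4),(3,0,1),(3,0,2),(3,0,4),(3,1,2),(3,1,4),
  (4,0,1),(4,0,2),(4,0,3),(4,1,2),(4,1,3)]
def uent : List (ℕ × ℕ) := [(2,3),(2,4),(3,2),(3,4),(4,2),(4,3)]
def colX : List ℕ := [7, 25, 42, 52, 7, 1, 2, 4, 25, 1, 8, 16, 42, 2, 8, 32, 52, 4, 16, 32]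
def colY : List ℕ := [25, 42, 52, 1, 2, 4, 391, 170, 308, 162, 292, 323, 89, 304, 81, 272, 196, 88,
  168, 72, 136]
def colZ : List ℕ := [63, 195, 76, 176, 1792, 960, 1088, 128, 1024, 20, 1028, 16, 256, 33, 257, 32,
  512, 10, 514, 8]

/-- bits of crossings between `t_i a` and `t_j b` -/
def xl (X : ℕ → ℕ → Bool) : List Bool := offd.map fun p => X p.1 p.2
def yl (Y : ℕ → ℕ → ℕ → Bool) : List Bool := yent.map fun p => Y p.1 p.2.1 p.2.2
def ul (U : ℕ → ℕ → Bool) : List Bool := uent.map fun p => U p.1 p.2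

theorem lin_lt (k : ℕ) : ∀ (cs : List ℕ), (∀ c ∈ cs, c < 2 ^ k) → ∀ bs, lin cs bs < 2 ^ k
  | [], _, _ => by simp [lin]
  | _ :: _, _, [] => by simp [lin]
  | c :: cs, h, b :: bs => by
    simp only [lin]
    apply Nat.xor_lt_two_pow
    · cases b <;> simp [h c]
    · exact lin_lt k cs (fun c hc => h c (by simp [hc])) bs



/-! ### symbolic xor sums -/

abbrev Atm := ℕ × ℕ × ℕ × ℕ

def sm (ρ : Atm → Bool) : List Atm → Bool
  | [] => false
  | a :: l => ρ a ^^ sm ρ l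

theorem sm_append (ρ : Atm → Bool) : ∀ l l', sm ρ (l ++ l') = (sm ρ l ^^ sm ρ l')
  | [], l' => by simp [sm]
  | a :: l, l' => by simp [sm, sm_append ρ l l', Bool.xor_assoc]

theorem sm_erase (ρ : Atm → Bool) (a : Atm) : ∀ l : List Atm, a ∈ l →
    sm ρ l = (ρ a ^^ sm ρ (l.erase a))
  | [], h => by simp at h
  | b :: l, h => by
    by_cases hb : b = a
    · subst hb; simp [sm]
    · have h' : a ∈ l := by
        rcases List.mem_cons.1 h with h | h
        · exact absurd h.symm hb
        · exact h
      have hb' : (b == a) = false := by simpa using hb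
      rw [List.erase_cons_tail (by simpa using hb)]
      simp only [sm, sm_erase ρ a l h']
      cases ρ a <;> cases ρ b <;> simp

def canc : ℕ → List Atm → Bool
  | _, [] => true
  | 0, _ :: _ => false
  | k + 1, a :: l => l.contains a && canc k (l.erase a)

theorem canc_sound (ρ : Atm → Bool) : ∀ k l, canc k l = true → sm ρ l = false
  | _, [], _ => rfl
  | 0, _ :: _, h => by simp [canc] at h
  | k + 1, a :: l, h => by
    simp only [canc, Bool.and_eq_true, List.contains_iff_mem] at h
    have := canc_sound ρ k _ h.2
    rw [sm, sm_erase ρ a l h.1, this]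
    simp

def lb (r : ℕ) : List ℕ → List (List Atm) → List Atm
  | c :: cs, l :: ls => (bif c.testBit r then l else []) ++ lb r cs ls
  | _, _ => []

theorem linb_sm (ρ : Atm → Bool) (r : ℕ) : ∀ cs ls,
    linb r cs (ls.map (sm ρ)) = sm ρ (lb r cs ls)
  | [], _ => by simp [linb, lb, sm]
  | _ :: _, [] => by simp [linb, lb, sm]
  | c :: cs, l :: ls => by
    simp only [List.map_cons, linb, lb, sm_append, linb_sm ρ r cs ls]
    cases c.testBit r <;> simp [sm]

theorem lin_sm_testBit (ρ : Atm → Bool) (r : ℕ) (cs : List ℕ) (ls : List (List Atm)) :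
    (lin cs (ls.map (sm ρ))).testBit r = sm ρ (lb r cs ls) := by
  rw [lin_testBit, linb_sm]

/-! ### the data -/

section data
variable (m k ν M : ℕ → ℕ → ℕ → Bool)

def Xb (i j a b : ℕ) : Bool :=
  decide (i < j) ^^ (decide (a < b) ^^ (true ^^ (m i a b ^^ (m j b a ^^ (k i j a ^^ k j i b)))))
def Yb (i a b c : ℕ) : Bool :=
  decide (b < a ∧ a < c) ^^ (m i a b ^^ (m i a c ^^ (ν i b c ^^ M b c a)))
def Ub (c d : ℕ) : Bool :=
  decide (c < d) ^^ (M 0 c 1 ^^ (M 0 c d ^^ (M 1 d 0 ^^ M 1 d c)))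

def xw (i j : ℕ) : List Bool := xl (Xb m k i j)
def yw (i : ℕ) : List Bool := yl (Yb m ν M i)
def uw : List Bool := ul (Ub M)
def tau (i : ℕ) : ℕ := lin colY (yw m ν M i)

/-- interpretation of atoms for the triple of indices `i j l` -/
def rho (i j l : ℕ) : Atm → Bool
  | (0, _, _, _) => true
  | (1, a, b, _) => m i a b
  | (2, a, b, _) => m j a b
  | (3, a, b, _) => m l a b
  | (4, 0, a, _) => k i j a
  | (4, 1, a, _) => k j i a
  | (4, 2, a, _) => k i l a
  | (4, 3, a, _) => k l i a
  | (4, 4, a, _) => k j l a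
  | (4, 5, a, _) => k l j a
  | (5, a, b, _) => ν i a b
  | (6, a, b, _) => ν j a b
  | (7, a, b, c) => M a b c
  | (8, 0, _, _) => decide (i < j)
  | (8, 1, _, _) => decide (i < l)
  | (8, 2, _, _) => decide (j < l)
  | _ => false

def cst (p : Prop) [Decidable p] : List Atm := if p then [(0,0,0,0)] else []

theorem sm_cst (p : Prop) [Decidable p] (i j l : ℕ) :
    sm (rho m k ν M i j l) (cst p) = decide p := by
  unfold cst; split_ifs with h <;> simp [sm, rho, h]

/-- symbolic version of `Xb`; `t t'` tags of the indices, `g g'` tags of the `k`s, `q` of order -/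
def sX (t t' g g' q : ℕ) (p : ℕ × ℕ) : List Atm :=
  (8, q, 0, 0) :: cst (p.1 < p.2) ++ [(0,0,0,0), (t, p.1, p.2, 0), (t', p.2, p.1, 0), (4, g, p.1, 0),
    (4, g', p.2, 0)]
def sY (t t' : ℕ) (p : ℕ × ℕ × ℕ) : List Atm :=
  cst (p.2.1 < p.1 ∧ p.1 < p.2.2) ++ [(t, p.1, p.2.1, 0), (t, p.1, p.2.2, 0), (t', p.2.1, p.2.2, 0),
    (7, p.2.1, p.2.2, p.1)]
def sU (p : ℕ × ℕ) : List Atm :=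
  cst (p.1 < p.2) ++ [(7, 0, p.1, 1), (7, 0, p.1, p.2), (7, 1, p.2, 0), (7, 1, p.2, p.1)]

theorem xw_ij (i j l : ℕ) : xw m k i j =
    (offd.map (sX 1 2 0 1 0)).map (sm (rho m k ν M i j l)) := by
  simp only [xw, xl, List.map_map]
  apply List.map_congr_left
  intro p _
  simp [sX, sm, sm_append, sm_cst, rho, Xb]

theorem xw_il (i j l : ℕ) : xw m k i l =
    (offd.map (sX 1 3 2 3 1)).map (sm (rho m k ν M i j l)) := by
  simp only [xw, xl, List.map_map]
  apply List.map_congr_left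
  intro p _
  simp [sX, sm, sm_append, sm_cst, rho, Xb]

theorem xw_jl (i j l : ℕ) : xw m k j l =
    (offd.map (sX 2 3 4 5 2)).map (sm (rho m k ν M i j l)) := by
  simp only [xw, xl, List.map_map]
  apply List.map_congr_left
  intro p _
  simp [sX, sm, sm_append, sm_cst, rho, Xb]

theorem yw_i (i j l : ℕ) : yw m ν M i =
    (yent.map (sY 1 5)).map (sm (rho m k ν M i j l)) := by
  simp only [yw, yl, List.map_map]
  apply List.map_congr_left
  intro p _
  simp [sY, sm, sm_append, sm_cst, rho, Yb]

theorem yw_j (i j l : ℕ) : yw m ν M j =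
    (yent.map (sY 2 6)).map (sm (rho m k ν M i j l)) := by
  simp only [yw, yl, List.map_map]
  apply List.map_congr_left
  intro p _
  simp [sY, sm, sm_append, sm_cst, rho, Yb]

theorem uw_eq (i j l : ℕ) : uw M =
    (uent.map sU).map (sm (rho m k ν M i j l)) := by
  simp only [uw, ul, List.map_map]
  apply List.map_congr_left
  intro p _
  simp [sU, sm, sm_append, sm_cst, rho, Ub]

theorem xor3 {a b c d e : Bool} (h : (a ^^ (b ^^ (c ^^ d))) = false) (he : e = d) :
    a = ((e ^^ b) ^^ c) := by
  subst he; revert h; cases a <;> cases b <;> cases c <;> cases e <;> decide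

theorem ck1 : ∀ r < 9, canc 1000 (lb r colX (offd.map (sX 1 2 0 1 0)) ++
    (lb r colY (yent.map (sY 1 5)) ++ (lb r colY (yent.map (sY 2 6)) ++
      cst ((63 : ℕ).testBit r = true)))) = true := by
  decide +kernel

theorem linX_eq (i j : ℕ) :
    lin colX (xw m k i j) = 63 ^^^ tau m ν M i ^^^ tau m ν M j := by
  apply Nat.eq_of_testBit_eq
  intro r
  by_cases hr : r < 9
  · have h := canc_sound (rho m k ν M i j 0) _ _ (ck1 r hr)
    rw [sm_append, sm_append, sm_append, sm_cst, ← lin_sm_testBit, ← lin_sm_testBit,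
      ← lin_sm_testBit, ← xw_ij, ← yw_i, ← yw_j] at h
    rw [Nat.testBit_xor, Nat.testBit_xor]
    exact xor3 h (by simp)
  · have h9 : ∀ x, x < 2 ^ 9 → x.testBit r = false := fun x hx =>
      Nat.testBit_lt_two_pow (hx.trans_le (Nat.pow_le_pow_right (by norm_num) (by omega)))
    rw [h9 _ (lin_lt 9 _ (by decide) _), h9]
    exact Nat.xor_lt_two_pow (Nat.xor_lt_two_pow (by norm_num) (lin_lt 9 _ (by decide) _))
      (lin_lt 9 _ (by decide) _)

end data

section data2
variable (m k ν M : ℕ → ℕ → ℕ → Bool)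

theorem lin_wt_zero : ∀ cs bs, wt bs = 0 → lin cs bs = 0
  | [], _, _ => by simp [lin]
  | _ :: _, [], _ => by simp [lin]
  | c :: cs, b :: bs, h => by
    simp only [wt] at h
    have hb : b = false := by cases b <;> simp_all
    subst hb
    simp [lin, lin_wt_zero cs bs (by simpa using h)]

theorem lin_wt_one : ∀ cs cs' bs, cs.length = cs'.length → bs.length = cs.length → wt bs = 1 →
    (lin cs bs, lin cs' bs) ∈ cs.zip cs'
  | [], [], [], _, _, h => by simp [wt] at h
  | c :: cs, c' :: cs', b :: bs, hl, hl', h => by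
    simp only [wt] at h
    cases b
    · simp only [lin, cond_false, Nat.zero_xor, List.zip_cons_cons]
      exact List.mem_cons_of_mem _ (lin_wt_one cs cs' bs (by simpa using hl) (by simpa using hl')
        (by simpa using h))
    · have h0 : wt bs = 0 := by simpa using h
      simp [lin, lin_wt_zero _ _ h0]

theorem wt_le_length : ∀ bs, wt bs ≤ bs.length
  | [] => by simp [wt]
  | b :: bs => by
    have := wt_le_length bs
    have := Bool.toNat_le b
    simp only [wt, List.length_cons]; omega

theorem ck2 : canc 1000 (lb 6 colY (yent.map (sY 1 5)) ++ (lb 7 colY (yent.map (sY 1 5)) ++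
    (lb 8 colY (yent.map (sY 1 5)) ++ (lb 0 [1,1,1,1,1,1] (uent.map sU) ++ cst True)))) = true := by
  decide +kernel

theorem u_pos (i : ℕ) (h : tau m ν M i < 64) : 1 ≤ wt (uw M) := by
  by_contra h0
  have h0 : wt (uw M) = 0 := by omega
  have h1 := canc_sound (rho m m ν M i 0 0) _ _ ck2
  rw [sm_append, sm_append, sm_append, sm_append, sm_cst, ← lin_sm_testBit, ← lin_sm_testBit,
      ← lin_sm_testBit, ← lin_sm_testBit, ← yw_i, ← uw_eq, lin_wt_zero _ _ h0] at h1
  change ((tau m ν M i).testBit 6 ^^ ((tau m ν M i).testBit 7 ^^ ((tau m ν M i).testBit 8 ^^ _)))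
    = false at h1
  have h6 : ∀ r, 6 ≤ r → (tau m ν M i).testBit r = false := fun r hr =>
    Nat.testBit_lt_two_pow (h.trans_le
      (le_trans (by norm_num) (Nat.pow_le_pow_right (n := 2) (by norm_num) hr)))
  rw [h6 6 (by norm_num), h6 7 (by norm_num), h6 8 (by norm_num)] at h1
  simp at h1

def colZT : List ℕ := [1792, 1024, 256, 512, 63, 20, 33, 10, 195, 960, 257, 514, 76, 1088, 1028, 8, 176, 128, 16, 32]
def colG : List ℕ := [1855,1219,332,688,980,1121,138,1285,530,40]
def gent : List (ℕ × ℕ) := [(0,1),(0,2),(0,3),(0,4),(1,2),(1,3),(1,4),(2,3),(2,4),(3,4)]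
def gl (i : ℕ) : List Bool := gent.map fun p => m i p.1 p.2 ^^ m i p.2 p.1
def Sy (i : ℕ) : ℕ := 820 ^^^ lin colG (gl m i)

theorem xw_ji {i j : ℕ} (l : ℕ) (h : i ≠ j) : xw m k j i =
    (offd.map (fun p => (0,0,0,0) :: sX 2 1 1 0 0 p)).map (sm (rho m k ν M i j l)) := by
  simp only [xw, xl, List.map_map]
  apply List.map_congr_left
  intro p _
  have : decide (j < i) = !decide (i < j) := by
    rcases lt_or_gt_of_ne h with h | h <;> simp [h, h.le]
  simp [sX, sm, sm_append, sm_cst, rho, Xb, this]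

theorem gl_i (i j l : ℕ) : gl m i =
    (gent.map (fun p => [(1, p.1, p.2, 0), (1, p.2, p.1, 0)])).map (sm (rho m k ν M i j l)) := by
  simp only [gl, List.map_map]
  apply List.map_congr_left
  intro p _
  simp [sm, rho]

theorem ck3 : ∀ r < 11, canc 1000 (lb r colZT (offd.map (sX 1 2 0 1 0)) ++
    lb r colZ (offd.map (fun p => (0,0,0,0) :: sX 2 1 1 0 0 p))) = true := by
  decide +kernel

theorem ck4 : ∀ r < 11, canc 1000 (lb r colZ (offd.map (fun p => (0,0,0,0) :: sX 2 1 1 0 0 p)) ++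
    (lb r colZ (offd.map (sX 1 3 2 3 1)) ++ (lb r colZ (offd.map (sX 2 3 4 5 2)) ++
    (lb r colG (gent.map (fun p => [(1, p.1, p.2, 0), (1, p.2, p.1, 0)])) ++
      cst ((820 : ℕ).testBit r = true))))) = true := by
  decide +kernel

theorem tb_big {x n r : ℕ} (hx : x < 2 ^ n) (hr : ¬ r < n) : x.testBit r = false :=
  Nat.testBit_lt_two_pow (hx.trans_le (Nat.pow_le_pow_right (by norm_num) (by omega)))

theorem zT_eq {i j : ℕ} (h : i ≠ j) : lin colZT (xw m k i j) = lin colZ (xw m k j i) := by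
  apply Nat.eq_of_testBit_eq
  intro r
  by_cases hr : r < 11
  · have h := canc_sound (rho m k m m i j 0) _ _ (ck3 r hr)
    rw [sm_append, ← lin_sm_testBit, ← lin_sm_testBit, ← xw_ij, ← xw_ji _ _ _ _ _ ‹_›] at h
    simpa using h
  · rw [tb_big (lin_lt 11 _ (by decide) _) hr, tb_big (lin_lt 11 _ (by decide) _) hr]

theorem xor5 {a b c d e f : Bool} (h : (a ^^ (b ^^ (c ^^ (d ^^ e)))) = false) (he : f = e) :
    c = ((f ^^ d) ^^ a ^^ b) := by
  subst he; revert h; cases a <;> cases b <;> cases c <;> cases d <;> cases f <;> decide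

theorem pivot {i j : ℕ} (l : ℕ) (h : i ≠ j) : lin colZ (xw m k j l) =
    Sy m i ^^^ lin colZ (xw m k j i) ^^^ lin colZ (xw m k i l) := by
  apply Nat.eq_of_testBit_eq
  intro r
  by_cases hr : r < 11
  · have h := canc_sound (rho m k m m i j l) _ _ (ck4 r hr)
    rw [sm_append, sm_append, sm_append, sm_append, sm_cst, ← lin_sm_testBit, ← lin_sm_testBit,
      ← lin_sm_testBit, ← lin_sm_testBit, ← xw_jl, ← xw_il, ← gl_i, ← xw_ji _ _ _ _ _ ‹_›] at h
    rw [Nat.testBit_xor, Nat.testBit_xor, Sy, Nat.testBit_xor]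
    exact xor5 h (by simp)
  · rw [tb_big (lin_lt 11 _ (by decide) _) hr, tb_big _ hr]
    exact Nat.xor_lt_two_pow (Nat.xor_lt_two_pow (Nat.xor_lt_two_pow (by norm_num)
      (lin_lt 11 _ (by decide) _)) (lin_lt 11 _ (by decide) _)) (lin_lt 11 _ (by decide) _)

def SS : List ℕ := [66,106,200,224,270,294,388,428,592,632,730,754,796,820,918,958,1035,1059,1153,
  1193,1351,1391,1485,1509,1561,1585,1683,1723,1877,1917,2015,2039]

theorem ckS : chk (fun s _ => SS.contains s) colG 10 0 820 = true := by decide +kernel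

theorem Sy_mem (i : ℕ) : Sy m i ∈ SS := by
  have := chk_sound _ _ _ _ _ ckS (gl m i) (by simp [gl, gent, colG])
    ((wt_le_length _).trans (by simp [gl, gent]))
  simpa [Sy] using this

def N2 : ℕ := 43797736970429166377561100043097206272838158797734226867093794827283713006070303073922389090898531421515936120639745430202003243204507764053464437999024975752757551977028389034545186492874587694184239115444837484453135439245856131045025470138441339297070136813748398241345578846937300556483391490724466373995300759375623605065815867655968312490345827027884030119940172675875246976758933192333360903893167817950780773120861974503883694222833413689789736166838442973515576487655196308518447283285556335390972325288584932401819198191722530208661622398709006670221790909104550006755656294609863359594518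

theorem ckN : chk (fun s w => w != 2 || N2.testBit s) colZ 2 0 0 = true := by decide +kernel

theorem xw_length (i j : ℕ) : (xw m k i j).length = 20 := by simp [xw, xl, offd]
theorem yw_length (i : ℕ) : (yw m ν M i).length = 21 := by simp [yw, yl, yent]

theorem N2_of {i j : ℕ} (h : wt (xw m k i j) = 2) : N2.testBit (lin colZ (xw m k i j)) = true := by
  have := chk_sound _ _ _ _ _ ckN (xw m k i j) (by simp [xw_length, colZ]) h.le
  simpa [h] using this

def Zp : List (ℕ × ℕ) := colZ.zip colZT
def adjZ (S : ℕ) (p q : ℕ × ℕ) : Bool :=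
  N2.testBit (S ^^^ p.2 ^^^ q.1) && N2.testBit (S ^^^ q.2 ^^^ p.1)

def clq (S : ℕ) : ℕ → List (ℕ × ℕ) → Bool
  | 0, _ => false
  | n + 1, L => L.all fun p => clq S n (L.filter (adjZ S p))

theorem ckA : ∀ S ∈ SS, clq S 4 Zp = true := by decide +kernel

def bad5 (S : ℕ) (p q r e : ℕ × ℕ) : Bool :=
  N2.testBit (S ^^^ p.2 ^^^ e.2) && colZ.contains (p.1 ^^^ e.1 ^^^ q.1) &&
    colZ.contains (p.1 ^^^ e.1 ^^^ r.1)
theorem ckB : ∀ S ∈ SS, (Zp.all fun p => (Zp.filter (adjZ S p)).all fun q =>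
    ((Zp.filter (adjZ S p)).filter (adjZ S q)).all fun r => Zp.all fun e => !bad5 S p q r e) = true := by
  decide +kernel

theorem mem_Zp {i j : ℕ} (hij : i ≠ j) (h : wt (xw m k i j) = 1) :
    (lin colZ (xw m k i j), lin colZ (xw m k j i)) ∈ Zp := by
  rw [← zT_eq m k hij]
  exact lin_wt_one _ _ _ (by decide) (by simp [xw_length, colZ]) h

theorem wt_symm (i j : ℕ) : wt (xw m k i j) = wt (xw m k j i) := by
  by_cases h : i = j
  · rw [h]
  have hd : decide (j < i) = !decide (i < j) := by
    rcases lt_or_gt_of_ne h with h | h <;> simp [h, h.le]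
  have : ∀ a b, a ≠ b → Xb m k i j a b = Xb m k j i b a := by
    intro a b hab
    have hd' : decide (b < a) = !decide (a < b) := by
      rcases lt_or_gt_of_ne hab with h | h <;> simp [h, h.le]
    simp only [Xb, hd, hd']
    cases decide (i < j) <;> cases decide (a < b) <;> cases m i a b <;> cases m j b a <;>
      cases k i j a <;> cases k j i b <;> rfl
  simp only [xw]
  generalize Xb m k i j = f at this
  generalize Xb m k j i = g at this
  simp only [xl, offd, List.map_cons, List.map_nil, wt]
  simp only [this 0 1 (by decide), this 0 2 (by decide), this 0 3 (by decide), this 0 4 (by decide),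
    this 1 0 (by decide), this 1 2 (by decide), this 1 3 (by decide), this 1 4 (by decide),
    this 2 0 (by decide), this 2 1 (by decide), this 2 3 (by decide), this 2 4 (by decide),
    this 3 0 (by decide), this 3 1 (by decide), this 3 2 (by decide), this 3 4 (by decide),
    this 4 0 (by decide), this 4 1 (by decide), this 4 2 (by decide), this 4 3 (by decide)]
  ring

theorem adjZ_of {i j l : ℕ} (hij : i ≠ j) (hil : i ≠ l)
    (h : wt (xw m k j l) = 2) : adjZ (Sy m i) (lin colZ (xw m k i j), lin colZ (xw m k j i))
      (lin colZ (xw m k i l), lin colZ (xw m k l i)) = true := by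
  simp only [adjZ, Bool.and_eq_true]
  rw [← pivot m k l hij, ← pivot m k j hil]
  exact ⟨N2_of m k h, N2_of m k (by rwa [wt_symm])⟩

theorem arrA {i : ℕ} {j : Fin 4 → ℕ} (hij : ∀ a, i ≠ j a) (h1 : ∀ a, wt (xw m k i (j a)) = 1)
    (h2 : ∀ a b, a ≠ b → wt (xw m k (j a) (j b)) = 2) : False := by
  have hc := ckA _ (Sy_mem m i)
  have hz := fun a => mem_Zp m k (hij a) (h1 a)
  have ha := fun a b hab => adjZ_of m k (hij a) (hij b) (h2 a b hab)
  simp only [clq, List.all_eq_true, List.mem_filter] at hc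
  have := hc _ (hz 0) _ ⟨hz 1, ha 0 1 (by decide)⟩ _ ⟨⟨hz 2, ha 0 2 (by decide)⟩, ha 1 2 (by decide)⟩ _
    ⟨⟨⟨hz 3, ha 0 3 (by decide)⟩, ha 1 3 (by decide)⟩, ha 2 3 (by decide)⟩
  simp at this

theorem arrB {i e : ℕ} {j : Fin 3 → ℕ} (hie : i ≠ e) (hij : ∀ a, i ≠ j a) (hej : ∀ a, e ≠ j a)
    (h1 : ∀ a, wt (xw m k i (j a)) = 1) (he : ∀ a, wt (xw m k e (j a)) = 1)
    (hie2 : wt (xw m k i e) = 2)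
    (h2 : ∀ a b, a ≠ b → wt (xw m k (j a) (j b)) = 2) : False := by
  have hc := ckB _ (Sy_mem m i)
  have hz := fun a => mem_Zp m k (hij a) (h1 a)
  have hze := fun a => mem_Zp m k (hej a) (he a)
  have ha := fun a b hab => adjZ_of m k (hij a) (hij b) (h2 a b hab)
  simp only [List.all_eq_true, List.mem_filter] at hc
  have h3 := hc _ (hz 0) _ ⟨hz 1, ha 0 1 (by decide)⟩ _ ⟨⟨hz 2, ha 0 2 (by decide)⟩, ha 1 2 (by decide)⟩
    _ (hze 0)
  have hd : ∀ a, lin colZ (xw m k i (j a)) ^^^ lin colZ (xw m k e (j a)) =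
      Sy m i ^^^ lin colZ (xw m k e i) := by
    intro a
    rw [pivot m k (j a) hie, Nat.xor_comm, Nat.xor_assoc, Nat.xor_self, Nat.xor_zero]
  have hcz : ∀ a, colZ.contains (lin colZ (xw m k i (j 0)) ^^^ lin colZ (xw m k e (j 0)) ^^^
      lin colZ (xw m k i (j a))) = true := by
    intro a
    rw [hd 0, ← hd a, Nat.xor_comm, ← Nat.xor_assoc, Nat.xor_self, Nat.zero_xor]
    simpa using (List.of_mem_zip (hze a)).1
  have hn : N2.testBit (Sy m i ^^^ lin colZ (xw m k (j 0) i) ^^^ lin colZ (xw m k (j 0) e)) = true := by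
    have := N2_of m k hie2
    rw [pivot m k e (hij 0)]
    rw [← Nat.xor_assoc, ← Nat.xor_assoc]
    have hx : ∀ a b c : ℕ, a ^^^ b ^^^ a ^^^ b ^^^ c = c := by
      intro a b c
      rw [Nat.xor_assoc a b a, Nat.xor_comm b a, ← Nat.xor_assoc, Nat.xor_self, Nat.zero_xor,
        Nat.xor_self, Nat.zero_xor]
    rw [hx]; exact this
  simp only [bad5, hcz, hn] at h3
  simp at h3

end data2

/-! ### Stage 1: the bound for `K_{5,n}` -/
section kleitman
open Finset

def EE (x : ℕ → ℕ → ℤ) (S : Finset ℕ) : ℤ := ∑ i ∈ S, ∑ j ∈ S, x i j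

theorem EE_insert {x : ℕ → ℕ → ℤ} (hs : ∀ i j, x i j = x j i) (hd : ∀ i, x i i = 0)
    {S : Finset ℕ} {a : ℕ} (ha : a ∉ S) : EE x (insert a S) = EE x S + 2 * ∑ j ∈ S, x a j := by
  unfold EE
  rw [sum_insert ha, sum_insert ha, hd]
  simp only [sum_insert ha, sum_add_distrib]
  rw [sum_congr rfl (fun i _ => hs i a)]
  ring

theorem EE_erase {x : ℕ → ℕ → ℤ} (hs : ∀ i j, x i j = x j i) (hd : ∀ i, x i i = 0)
    {S : Finset ℕ} {a : ℕ} (ha : a ∈ S) : EE x S = EE x (S.erase a) + 2 * ∑ j ∈ S, x a j := by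
  conv_lhs => rw [← insert_erase ha]
  rw [EE_insert hs hd (notMem_erase a S), ← sum_erase_add S _ ha, hd]
  ring

theorem EE_mod {x : ℕ → ℕ → ℤ} (hs : ∀ i j, x i j = x j i) (hd : ∀ i, x i i = 0)
    {u : ℕ → ℤ} (hu : ∀ i j, i ≠ j → (2 : ℤ) ∣ x i j - u i - u j) (S : Finset ℕ) :
    (4 : ℤ) ∣ EE x S - 2 * ((S.card : ℤ) - 1) * ∑ i ∈ S, u i := by
  induction S using Finset.induction_on with
  | empty => simp [EE]
  | insert a S ha ih =>
    rw [EE_insert hs hd ha, sum_insert ha, card_insert_of_notMem ha]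
    have h2 : (2 : ℤ) ∣ ∑ j ∈ S, (x a j - u a - u j) :=
      dvd_sum fun j hj => hu a j (by rintro rfl; exact ha hj)
    rw [sum_sub_distrib, sum_sub_distrib, sum_const, nsmul_eq_mul] at h2
    obtain ⟨p, hp⟩ := ih
    obtain ⟨q, hq⟩ := h2
    refine ⟨p + q, ?_⟩
    push_cast
    linear_combination hp + 2 * hq

structure KH (x : ℕ → ℕ → ℤ) : Prop where
  symm : ∀ i j, x i j = x j i
  diag : ∀ i, x i i = 0
  nonneg : ∀ i j, 0 ≤ x i j
  par : ∃ u : ℕ → ℤ, ∀ i j, i ≠ j → (2 : ℤ) ∣ x i j - u i - u j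
  tri : ∀ i j l, i ≠ j → i ≠ l → j ≠ l → 4 ≤ x i j + x i l + x j l
  cA : ∀ (i : ℕ) (j : Fin 4 → ℕ), (∀ a, i ≠ j a) → Function.Injective j → (∀ a, x i (j a) = 1) →
    (∀ a b, a ≠ b → x (j a) (j b) = 2) → False
  cB : ∀ (i e : ℕ) (j : Fin 3 → ℕ), i ≠ e → (∀ a, i ≠ j a) → (∀ a, e ≠ j a) →
    Function.Injective j → (∀ a, x i (j a) = 1) → (∀ a, x e (j a) = 1) → x i e = 2 →
    (∀ a b, a ≠ b → x (j a) (j b) = 2) → False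

theorem exists_inj_of_card {S : Finset ℕ} {n : ℕ} (h : n ≤ S.card) :
    ∃ j : Fin n → ℕ, Function.Injective j ∧ ∀ a, j a ∈ S := by
  obtain ⟨T, hT, hc⟩ := exists_subset_card_eq h
  refine ⟨fun a => T.orderEmbOfFin hc a, fun a b hab => (T.orderEmbOfFin hc).injective hab,
    fun a => hT (T.orderEmbOfFin_mem hc a)⟩

/-- the odd case, exclusion of the value one below -/
theorem kl_odd {x : ℕ → ℕ → ℤ} (H : KH x) {S : Finset ℕ} {k : ℕ} (hk : 2 ≤ k)
    (hc : S.card = 2 * k + 1)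
    (h1 : ∀ i ∈ S, 8 * (k : ℤ) * (k - 1) ≤ EE x (S.erase i))
    (h2 : ∀ i ∈ S, ∀ j ∈ S, i ≠ j → 8 * ((k : ℤ) - 1) * (k - 1) ≤ EE x ((S.erase i).erase j))
    (hE : EE x S = 8 * k * k - 4) : False := by
  have hk' : (2 : ℤ) ≤ k := by exact_mod_cast hk
  set r : ℕ → ℤ := fun i => ∑ j ∈ S, x i j with hr
  have hr1 : ∀ i ∈ S, EE x S = EE x (S.erase i) + 2 * r i := fun i hi => EE_erase H.symm H.diag hi
  have hr2 : ∀ i ∈ S, ∀ j ∈ S, i ≠ j → EE x S = EE x ((S.erase i).erase j) + 2 * r i + 2 * r j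
      - 2 * x i j := by
    intro i hi j hj hij
    rw [hr1 i hi, EE_erase H.symm H.diag (mem_erase.2 ⟨hij.symm, hj⟩)]
    have : r j = ∑ l ∈ S.erase i, x j l + x j i := (sum_erase_add S _ hi).symm
    rw [this, H.symm j i]; ring
  set s : ℕ → ℤ := fun i => 4 * k - 2 - r i with hs
  have hs0 : ∀ i ∈ S, 0 ≤ s i := by
    intro i hi
    have := h1 i hi
    have := hr1 i hi
    simp only [hs]; nlinarith
  have hsum : ∑ i ∈ S, s i = 2 := by
    simp only [hs, sum_sub_distrib, sum_const, nsmul_eq_mul, hc]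
    have : ∑ i ∈ S, r i = EE x S := rfl
    rw [this, hE]; push_cast; ring
  have hx : ∀ i ∈ S, ∀ j ∈ S, i ≠ j → 2 - s i - s j ≤ x i j := by
    intro i hi j hj hij
    have := h2 i hi j hj hij
    have := hr2 i hi j hj hij
    simp only [hs]; nlinarith
  -- there is an element with s positive
  obtain ⟨a, ha, hsa⟩ : ∃ a ∈ S, 0 < s a := by
    by_contra hcon
    push Not at hcon
    have := sum_nonpos hcon
    omega
  have hsum_a : s a + ∑ i ∈ S.erase a, s i = 2 := by rw [add_sum_erase S s ha, hsum]
  have hnn : 0 ≤ ∑ i ∈ S.erase a, s i := sum_nonneg fun i hi => hs0 i (mem_of_mem_erase hi)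
  have hca : (S.erase a).card = 2 * k := by rw [card_erase_of_mem ha, hc]; rfl
  rcases (by omega : s a = 2 ∨ s a = 1) with h | h
  · have h0 : ∀ i ∈ S.erase a, s i = 0 := by
      have : ∑ i ∈ S.erase a, s i = 0 := by omega
      exact (sum_eq_zero_iff_of_nonneg fun i hi => hs0 i (mem_of_mem_erase hi)).1 this
    have hx0 : ∀ j ∈ S.erase a, x a j = 0 := by
      intro j hj
      have hjS := mem_of_mem_erase hj
      have hja := ne_of_mem_erase hj
      have e1 : r j = x j j + (x j a + ∑ l ∈ (S.erase a).erase j, x j l) := by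
        simp only [hr]
        rw [← add_sum_erase S _ ha, ← add_sum_erase (S.erase a) _ hj]; ring
      have e2 : ((S.erase a).erase j).card • (2 : ℤ) ≤ ∑ l ∈ (S.erase a).erase j, x j l := by
        apply card_nsmul_le_sum
        intro l hl
        have hl' := mem_of_mem_erase hl
        have := hx j hjS l (mem_of_mem_erase hl') (ne_of_mem_erase hl).symm
        rw [h0 j hj, h0 l hl'] at this
        linarith
      rw [card_erase_of_mem hj, hca, nsmul_eq_mul] at e2
      push_cast [Nat.cast_sub (show 1 ≤ 2 * k by omega)] at e2
      have e3 := h0 j hj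
      have e4 := H.nonneg a j
      simp only [hs] at e3
      rw [H.diag, H.symm j a] at e1
      linarith
    have : r a = 0 := by
      simp only [hr]
      rw [← add_sum_erase S _ ha, H.diag, sum_congr rfl hx0]; simp
    simp only [hs] at h
    linarith
  · obtain ⟨b, hb, hsb⟩ : ∃ b ∈ S.erase a, 0 < s b := by
      by_contra hcon
      push Not at hcon
      have := sum_nonpos hcon
      omega
    have hba := ne_of_mem_erase hb
    have hbS := mem_of_mem_erase hb
    have hsum_b : s b + ∑ i ∈ (S.erase a).erase b, s i = 1 := by
      rw [add_sum_erase _ s hb]; omega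
    set R := (S.erase a).erase b with hR
    have hRS : ∀ i ∈ R, i ∈ S ∧ i ≠ a ∧ i ≠ b := by
      intro i hi
      simp only [hR, mem_erase] at hi; tauto
    have hnn' : 0 ≤ ∑ i ∈ R, s i := sum_nonneg fun i hi => hs0 i (hRS i hi).1
    have hsb1 : s b = 1 := by omega
    have h0 : ∀ i ∈ R, s i = 0 := by
      have : ∑ i ∈ R, s i = 0 := by omega
      exact (sum_eq_zero_iff_of_nonneg fun i hi => hs0 i (hRS i hi).1).1 this
    have hcR : R.card = 2 * k - 1 := by rw [hR, card_erase_of_mem hb, hca]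
    have hsplit : ∀ j, r j = x j a + x j b + ∑ l ∈ R, x j l := by
      intro j
      simp only [hr]
      rw [← add_sum_erase S _ ha, ← add_sum_erase (S.erase a) _ hb]; ring
    have key : ∀ j ∈ R, x a j = 1 ∧ x b j = 1 ∧ ∀ l ∈ R, l ≠ j → x j l = 2 := by
      intro j hj
      obtain ⟨hjS, hja, hjb⟩ := hRS j hj
      have f1 := hx a ha j hjS hja.symm
      have f2 := hx b hbS j hjS hjb.symm
      rw [h, h0 j hj] at f1
      rw [hsb1, h0 j hj] at f2
      have f3 : ∀ l ∈ R.erase j, 0 ≤ x j l - 2 := by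
        intro l hl
        have hl' := mem_of_mem_erase hl
        have := hx j hjS l (hRS l hl').1 (ne_of_mem_erase hl).symm
        rw [h0 j hj, h0 l hl'] at this
        linarith
      have f4 := hsplit j
      rw [← add_sum_erase R _ hj, H.diag] at f4
      have f5 : ∑ l ∈ R.erase j, x j l = ∑ l ∈ R.erase j, (x j l - 2) + (4 * k - 4) := by
        rw [sum_sub_distrib, sum_const, card_erase_of_mem hj, hcR, nsmul_eq_mul,
          show 2 * k - 1 - 1 = 2 * (k - 1) by omega]
        push_cast [Nat.cast_sub (show 1 ≤ k by omega)]; ring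
      have f6 := h0 j hj
      simp only [hs] at f6
      have f7 : 0 ≤ ∑ l ∈ R.erase j, (x j l - 2) := sum_nonneg f3
      rw [H.symm j a, H.symm j b] at f4
      refine ⟨by linarith, by linarith, ?_⟩
      intro l hl hlj
      have f8 : ∑ l ∈ R.erase j, (x j l - 2) = 0 := by linarith
      have := (sum_eq_zero_iff_of_nonneg f3).1 f8 l (mem_erase.2 ⟨hlj, hl⟩)
      linarith
    by_cases hk3 : 3 ≤ k
    · obtain ⟨j, hj, hjR⟩ := exists_inj_of_card (S := R) (n := 4) (by omega)
      exact H.cA a j (fun t => (hRS _ (hjR t)).2.1.symm) hj (fun t => (key _ (hjR t)).1)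
        (fun t t' htt => (key _ (hjR t)).2.2 _ (hjR t') (fun he => htt (hj he).symm))
    · have hk2 : k = 2 := by omega
      obtain ⟨j, hj, hjR⟩ := exists_inj_of_card (S := R) (n := 3) (by omega)
      refine H.cB a b j hba.symm (fun t => (hRS _ (hjR t)).2.1.symm)
        (fun t => (hRS _ (hjR t)).2.2.symm) hj (fun t => (key _ (hjR t)).1)
        (fun t => (key _ (hjR t)).2.1) ?_
        (fun t t' htt => (key _ (hjR t)).2.2 _ (hjR t') (fun he => htt (hj he).symm))
      have g1 := hsplit a
      rw [H.diag, sum_congr rfl (fun l hl => (key l hl).1), sum_const, hcR, hk2] at g1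
      simp only [hs, hk2] at h
      norm_num at g1 h
      linarith

def zz (n : ℕ) : ℤ := 4 * (n / 2 : ℕ) * ((n - 1) / 2 : ℕ)

theorem zz_even (k : ℕ) (hk : 1 ≤ k) : zz (2 * k) = 4 * k * (k - 1) := by
  unfold zz
  rw [show 2 * k / 2 = k by omega, show (2 * k - 1) / 2 = k - 1 by omega]
  push_cast [Nat.cast_sub hk]; ring

theorem zz_odd (k : ℕ) : zz (2 * k + 1) = 4 * k * k := by
  unfold zz
  rw [show (2 * k + 1) / 2 = k by omega, show (2 * k + 1 - 1) / 2 = k by omega]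

theorem sum_erase_EE {x : ℕ → ℕ → ℤ} (H : KH x) (S : Finset ℕ) :
    ∑ i ∈ S, EE x (S.erase i) = ((S.card : ℤ) - 2) * EE x S := by
  have : ∀ i ∈ S, EE x (S.erase i) = EE x S - 2 * ∑ j ∈ S, x i j := fun i hi => by
    rw [EE_erase H.symm H.diag hi]; ring
  rw [sum_congr rfl this, sum_sub_distrib, sum_const, nsmul_eq_mul, ← mul_sum]
  change _ - 2 * EE x S = _
  ring

theorem kleitman {x : ℕ → ℕ → ℤ} (H : KH x) (S : Finset ℕ) : 2 * zz S.card ≤ EE x S := by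
  have hnn : ∀ S : Finset ℕ, 0 ≤ EE x S := fun S =>
    sum_nonneg fun i _ => sum_nonneg fun j _ => H.nonneg i j
  induction hn : S.card using Nat.strong_induction_on generalizing S with
  | _ n ih =>
  subst hn
  by_cases hsm : S.card ≤ 2
  · have : zz S.card = 0 := by interval_cases S.card <;> simp [zz]
    rw [this]; simpa using hnn S
  have hdel : ∀ i ∈ S, 2 * zz (S.card - 1) ≤ EE x (S.erase i) := fun i hi =>
    ih _ (by have := card_pos.2 ⟨i, hi⟩; omega) _ (card_erase_of_mem hi)
  have hsum := card_nsmul_le_sum S _ _ hdel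
  rw [sum_erase_EE H, nsmul_eq_mul] at hsum
  rcases Nat.even_or_odd' S.card with ⟨k, hk | hk⟩
  · rw [hk, show 2 * k - 1 = 2 * (k - 1) + 1 by omega, zz_odd] at hsum
    rw [hk, zz_even k (by omega)]
    have hk1 : 2 ≤ k := by omega
    push_cast [Nat.cast_sub (show 1 ≤ k by omega)] at hsum
    have hk' : (2 : ℤ) ≤ k := by exact_mod_cast hk1
    nlinarith
  · rw [hk, zz_odd]
    by_cases hk1 : k = 1
    · subst hk1
      obtain ⟨a, b, c, hab, hac, hbc, rfl⟩ := card_eq_three.1 hk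
      have := H.tri a b c hab hac hbc
      simp only [EE]
      simp only [sum_insert (show a ∉ ({b, c} : Finset ℕ) by simp [hab, hac]),
        sum_insert (show b ∉ ({c} : Finset ℕ) by simp [hbc]), sum_singleton, H.diag]
      rw [H.symm b a, H.symm c a, H.symm c b]
      push_cast; linarith
    have hk2 : 2 ≤ k := by omega
    have hk' : (2 : ℤ) ≤ k := by exact_mod_cast hk2
    by_contra hlt
    push Not at hlt
    obtain ⟨u, hu⟩ := H.par
    have h4 : (4 : ℤ) ∣ EE x S := by
      have := EE_mod H.symm H.diag hu S
      rw [hk] at this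
      push_cast at this
      have h' : (4 : ℤ) ∣ 2 * (2 * (k : ℤ) + 1 - 1) * ∑ i ∈ S, u i :=
        ⟨k * ∑ i ∈ S, u i, by ring⟩
      simpa using dvd_add this h'
    rw [hk, show 2 * k + 1 - 1 = 2 * k by omega, zz_even k (by omega)] at hsum
    push_cast at hsum
    have hlow : 8 * (k : ℤ) * k - 8 < EE x S := by nlinarith
    have hE : EE x S = 8 * k * k - 4 := by
      obtain ⟨q, hq⟩ := h4
      rw [hq] at hlow hlt ⊢
      have a1 : q < 2 * k * k := by nlinarith
      have a2 : 2 * (k : ℤ) * k - 2 < q := by nlinarith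
      have : q = 2 * k * k - 1 := by omega
      rw [this]; ring
    refine kl_odd H hk2 hk ?_ ?_ hE
    · intro i hi
      have := hdel i hi
      rw [hk, show 2 * k + 1 - 1 = 2 * k by omega, zz_even k (by omega)] at this
      linarith
    · intro i hi j hj hij
      have := ih (2 * (k - 1) + 1) (by omega) ((S.erase i).erase j) (by
        rw [card_erase_of_mem (mem_erase.2 ⟨hij.symm, hj⟩), card_erase_of_mem hi]; omega)
      rw [zz_odd] at this
      push_cast [Nat.cast_sub (show 1 ≤ k by omega)] at this
      linarith

end kleitman

/-! ### Stage 2 -/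
section stage2
open Finset

def Fl : List ℕ := [0,1,1,2,1,2,2,1,1,2,2,3,2,3,3,2,1,2,2,3,2,3,3,2,2,1,3,2,3,2,2,3,1,2,2,3,2,3,3,2,
  2,3,1,2,3,2,2,3,2,3,3,2,1,2,2,3,3,2,2,3,2,3,3,4]
def F (s : ℕ) : ℕ := Fl.getD s 0
def G (s t : ℕ) : ℤ := F (63 ^^^ s ^^^ t)

theorem G_symm (s t : ℕ) : G s t = G t s := by
  simp only [G, Nat.xor_assoc, Nat.xor_comm s t]

theorem G_self (s : ℕ) : G s s = 4 := by
  simp only [G, Nat.xor_assoc, Nat.xor_self]; decide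

theorem F_tri : ∀ a < 64, ∀ b < 64, 4 ≤ F a + F b + F (63 ^^^ (a ^^^ b)) := by decide +kernel

theorem xor_lt64 {s t : ℕ} (h : s / 64 = t / 64) : 63 ^^^ s ^^^ t < 64 := by
  have : (63 ^^^ s ^^^ t) / 2 ^ 6 = 0 := by
    rw [Nat.xor_div_two_pow, Nat.xor_div_two_pow, show (2 : ℕ) ^ 6 = 64 by norm_num, h]
    simp
  rw [Nat.div_eq_zero_iff] at this
  simpa using this

theorem G_tri {s t u : ℕ} (h1 : s / 64 = t / 64) (h2 : s / 64 = u / 64) :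
    4 ≤ G s t + G s u + G t u := by
  have := F_tri _ (xor_lt64 h1) _ (xor_lt64 h2)
  have e : (63 ^^^ ((63 ^^^ s ^^^ t) ^^^ (63 ^^^ s ^^^ u))) = 63 ^^^ t ^^^ u := by
    apply Nat.eq_of_testBit_eq
    intro i
    simp only [Nat.testBit_xor]
    cases s.testBit i <;> cases t.testBit i <;> cases u.testBit i <;> cases (63 : ℕ).testBit i <;> rfl
  rw [e] at this
  simp only [G]; exact_mod_cast this

theorem G_nonneg (s t : ℕ) : 0 ≤ G s t := by simp [G]

def WW (x : ℕ → ℕ → ℤ) (c : ℕ → ℤ) (S : Finset ℕ) : ℤ := EE x S + 2 * ∑ i ∈ S, c i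
def bb (n : ℕ) : ℤ := zz n + (3 * n / 2 : ℕ)

theorem bb_step (n : ℕ) (hn : 2 ≤ n) : bb n = bb (n - 2) + 4 * n - 5 := by
  obtain ⟨n, rfl⟩ := Nat.exists_eq_add_of_le' hn
  rw [show n + 2 - 2 = n by omega]
  unfold bb
  have e3 : 3 * (n + 2) / 2 = 3 * n / 2 + 3 := by omega
  rw [e3]
  rcases Nat.even_or_odd' n with ⟨k, rfl | rfl⟩
  · rcases Nat.eq_zero_or_pos k with rfl | hk
    · simp [zz]
    · rw [show 2 * k + 2 = 2 * (k + 1) by ring, zz_even k hk, zz_even (k + 1) (by omega)]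
      push_cast; ring
  · rw [show 2 * k + 1 + 2 = 2 * (k + 1) + 1 by ring, zz_odd, zz_odd]
    push_cast; ring

structure SH (x : ℕ → ℕ → ℤ) (c : ℕ → ℤ) (τ : ℕ → ℕ) : Prop extends KH x where
  hx : ∀ i j, i ≠ j → G (τ i) (τ j) ≤ x i j
  c0 : ∀ i, 0 ≤ c i
  hw : ∀ i j, τ i / 64 = τ j / 64

variable {x : ℕ → ℕ → ℤ} {c : ℕ → ℤ} {τ : ℕ → ℕ}

theorem step (H : SH x c τ) {S : Finset ℕ} {e : ℤ}
    (ih : ∀ S' : Finset ℕ, S'.card < S.card → 2 * bb S'.card - e ≤ WW x c S')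
    {i j : ℕ} (hi : i ∈ S) (hj : j ∈ S) (hij : i ≠ j)
    (h : 3 + G (τ i) (τ j) - c i - c j ≤ ∑ l ∈ S, (G (τ i) (τ l) + G (τ j) (τ l) - 4)) :
    2 * bb S.card - e ≤ WW x c S := by
  have hj' : j ∈ S.erase i := mem_erase.2 ⟨hij.symm, hj⟩
  have hi' : i ∉ (S.erase i).erase j := by simp
  set R := (S.erase i).erase j with hR
  have hc1 : (S.erase i).card + 1 = S.card := card_erase_add_one hi
  have hc2 : R.card + 1 = (S.erase i).card := card_erase_add_one hj'
  have sp : ∀ g : ℕ → ℤ, ∑ l ∈ S, g l = g i + (g j + ∑ l ∈ R, g l) := by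
    intro g
    rw [← add_sum_erase S g hi, ← add_sum_erase _ g hj']
  have e1 : EE x S = EE x R + 2 * x i j + 2 * ∑ l ∈ R, (x i l + x j l) := by
    rw [EE_erase H.symm H.diag hi, EE_erase H.symm H.diag hj', sp, sum_add_distrib, H.diag,
      ← add_sum_erase _ _ hj', H.diag]
    ring
  have e2 : ∑ l ∈ R, (G (τ i) (τ l) + G (τ j) (τ l)) ≤ ∑ l ∈ R, (x i l + x j l) := by
    apply sum_le_sum
    intro l hl
    simp only [hR, mem_erase] at hl
    have := H.hx i l (Ne.symm hl.2.1)
    have := H.hx j l (Ne.symm hl.1)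
    linarith
  have e3 := H.hx i j hij
  have e4 := ih R (by omega)
  rw [sum_sub_distrib, sp, G_self, G_self, G_symm (τ j) (τ i), sum_const, nsmul_eq_mul] at h
  have e5 := bb_step S.card (by omega)
  rw [show S.card - 2 = R.card by omega] at e5
  have e6 := sp c
  unfold WW at e4 ⊢
  linarith

def Q1 : List ℕ := [72,81,88,89,136,162,168,170,196,272,292,304,308,323,391]

theorem Q1_ck : ∀ p ∈ Q1, ∀ q ∈ Q1, p / 64 = q / 64 → ∀ t ∈ Q1, p / 64 = t / 64 →
    (F (63 ^^^ p ^^^ q) = 2 ∧ 6 ≤ F (63 ^^^ p ^^^ t) + F (63 ^^^ q ^^^ t)) ∨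
    (F (63 ^^^ p ^^^ q) = 3 ∧ (F (63 ^^^ p ^^^ t) ≠ 2 → F (63 ^^^ q ^^^ t) ≠ 2 →
      7 ≤ F (63 ^^^ p ^^^ t) + F (63 ^^^ q ^^^ t))) ∨ F (63 ^^^ p ^^^ q) = 4 := by
  decide +kernel

theorem Q1_G {p q t : ℕ} (hp : p ∈ Q1) (hq : q ∈ Q1) (ht : t ∈ Q1) (h : p / 64 = q / 64)
    (h' : p / 64 = t / 64) :
    (G p q = 2 ∧ 6 ≤ G p t + G q t) ∨
    (G p q = 3 ∧ (G p t ≠ 2 → G q t ≠ 2 → 7 ≤ G p t + G q t)) ∨ G p q = 4 := by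
  have := Q1_ck p hp q hq h t ht h'
  unfold G
  exact_mod_cast this

theorem stage2a (H : SH x c τ) (h1 : ∀ i, 1 ≤ c i) (hQ : ∀ i, c i = 1 → τ i ∈ Q1)
    (S : Finset ℕ) : 2 * bb S.card - 0 ≤ WW x c S := by
  induction hn : S.card using Nat.strong_induction_on generalizing S with
  | _ n ih =>
  subst hn
  have ih' : ∀ S' : Finset ℕ, S'.card < S.card → 2 * bb S'.card - 0 ≤ WW x c S' :=
    fun S' h => ih _ h S' rfl
  by_contra hlt
  have hK := kleitman H.toKH S
  set C := ∑ i ∈ S, c i with hC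
  have hC2 : 2 * C + 2 ≤ 3 * S.card := by
    unfold WW bb at hlt
    omega
  -- two elements with c = 1
  set P := S.filter (fun i => c i = 1) with hP
  have hPc : 2 ≤ P.card := by
    by_contra hp
    have : ∑ i ∈ S, (2 - if c i = 1 then 1 else 0 : ℤ) ≤ C := by
      apply sum_le_sum
      intro i _
      have := h1 i
      split_ifs <;> omega
    rw [sum_sub_distrib, sum_boole, sum_const, nsmul_eq_mul] at this
    change _ - (P.card : ℤ) ≤ C at this
    have : P.card ≤ S.card := card_le_card (filter_subset _ _)
    omega
  have hstep : ∀ i ∈ P, ∀ j ∈ P, i ≠ j → ¬ (1 + G (τ i) (τ j)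
      ≤ ∑ l ∈ S, (G (τ i) (τ l) + G (τ j) (τ l) - 4)) := by
    intro i hi j hj hij h
    simp only [hP, mem_filter] at hi hj
    apply hlt
    apply step H ih' hi.1 hj.1 hij
    rw [hi.2, hj.2]; linarith
  have hlin : ∀ α β : ℤ, ∑ l ∈ S, (α - β * c l) = α * S.card - β * C := by
    intro α β
    rw [sum_sub_distrib, ← mul_sum, sum_const, nsmul_eq_mul]; ring
  have hQ' : ∀ i ∈ P, τ i ∈ Q1 := fun i hi => hQ i (mem_filter.1 hi).2
  obtain ⟨i0, hi0, j0, hj0, hij0⟩ := one_lt_card.1 (show 1 < P.card by omega)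
  by_cases hA : ∃ i ∈ P, ∃ j ∈ P, G (τ i) (τ j) = 2
  · obtain ⟨i, hi, j, hj, hg⟩ := hA
    have hij : i ≠ j := by rintro rfl; rw [G_self] at hg; omega
    apply hstep i hi j hj hij
    have : ∑ l ∈ S, (6 - 4 * c l) ≤ ∑ l ∈ S, (G (τ i) (τ l) + G (τ j) (τ l) - 4) := by
      apply sum_le_sum
      intro l hl
      rcases eq_or_lt_of_le (h1 l) with h | h
      · rcases Q1_G (hQ' i hi) (hQ' j hj) (hQ l h.symm) (H.hw _ _) (H.hw _ _) with h | h | h <;> omega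
      · have := G_tri (H.hw i j) (H.hw i l)
        omega
    rw [hlin] at this
    rw [hg]; linarith
  · push Not at hA
    by_cases hB : ∃ i ∈ P, ∃ j ∈ P, G (τ i) (τ j) = 3
    · obtain ⟨i, hi, j, hj, hg⟩ := hB
      have hij : i ≠ j := by rintro rfl; rw [G_self] at hg; omega
      apply hstep i hi j hj hij
      have : ∑ l ∈ S, (9 - 6 * c l) ≤ ∑ l ∈ S, (G (τ i) (τ l) + G (τ j) (τ l) - 4) := by
        apply sum_le_sum
        intro l hl
        rcases eq_or_lt_of_le (h1 l) with h | h
        · have hlP : l ∈ P := by simp [hP, hl, ← h]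
          have a1 := hA i hi l hlP
          have a2 := hA j hj l hlP
          rcases Q1_G (hQ' i hi) (hQ' j hj) (hQ l h.symm) (H.hw _ _) (H.hw _ _) with h | h | h
          · omega
          · have := h.2 a1 a2; omega
          · omega
        · have := G_tri (H.hw i j) (H.hw i l)
          omega
      rw [hlin] at this
      rw [hg]; linarith
    · push Not at hB
      have h4 : ∀ i ∈ P, ∀ j ∈ P, G (τ i) (τ j) = 4 := by
        intro i hi j hj
        have a1 := hA i hi j hj
        have a2 := hB i hi j hj
        rcases Q1_G (hQ' i hi) (hQ' j hj) (hQ' j hj) (H.hw _ _) (H.hw _ _) with h | h | h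
        · omega
        · omega
        · exact h
      apply hstep i0 hi0 j0 hj0 hij0
      have : ∑ l ∈ S, (12 - 8 * c l) ≤ ∑ l ∈ S, (G (τ i0) (τ l) + G (τ j0) (τ l) - 4) := by
        apply sum_le_sum
        intro l hl
        rcases eq_or_lt_of_le (h1 l) with h | h
        · have hlP : l ∈ P := by simp [hP, hl, ← h]
          rw [h4 _ hi0 _ hlP, h4 _ hj0 _ hlP]; omega
        · have := G_nonneg (τ i0) (τ l)
          have := G_nonneg (τ j0) (τ l)
          omega
      rw [hlin] at this
      rw [h4 _ hi0 _ hj0]; linarith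

end stage2

section stage2b
open Finset
variable {x : ℕ → ℕ → ℤ} {c : ℕ → ℤ} {τ : ℕ → ℕ}

def P1 : Finset ℕ := {1, 2, 4, 25, 42, 52}
/-- total deficiency with respect to the states in `P1` -/
def neg (s : ℕ) : ℕ := ∑ p ∈ P1, (2 - F (63 ^^^ s ^^^ p))

theorem neg_ck : ∀ s < 64, neg s ≤ 6 := by decide +kernel
theorem P1_ck : ∀ p ∈ P1, ∀ q ∈ P1, p ≠ q → F (63 ^^^ p ^^^ q) = 2 := by decide +kernel
theorem P1_ck0 : ∀ p ∈ P1, F (63 ^^^ p ^^^ 0) = 3 := by decide +kernel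

theorem P1_G {p q : ℕ} (hp : p ∈ P1) (hq : q ∈ P1) (h : p ≠ q) : G p q = 2 := by
  unfold G; exact_mod_cast P1_ck p hp q hq h
theorem P1_G0 {p : ℕ} (hp : p ∈ P1) : G p 0 = 3 := by
  unfold G; exact_mod_cast P1_ck0 p hp

theorem neg_le {T : Finset ℕ} (hT : T ⊆ P1) (s : ℕ) : - (neg s : ℤ) ≤ ∑ p ∈ T, (G s p - 2) := by
  have h1 : ∑ p ∈ T, (2 - F (63 ^^^ s ^^^ p)) ≤ neg s :=
    sum_le_sum_of_subset hT
  have h2 : ∑ p ∈ T, (-((2 - F (63 ^^^ s ^^^ p) : ℕ) : ℤ)) ≤ ∑ p ∈ T, (G s p - 2) := by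
    apply sum_le_sum
    intro p _
    unfold G; omega
  rw [sum_neg_distrib, ← Nat.cast_sum] at h2
  omega

structure TH (x : ℕ → ℕ → ℤ) (c : ℕ → ℤ) (τ : ℕ → ℕ) : Prop extends SH x c τ where
  lt : ∀ i, τ i < 64
  t0 : ∀ i, c i = 0 → τ i = 0
  t1 : ∀ i, c i = 1 → τ i ∈ P1
  t2 : ∀ i, c i = 2 → 2 ≤ G (τ i) 0 ∧ neg (τ i) ≤ 2

theorem st_small (H : TH x c τ) (S : Finset ℕ) (hS : S.card ≤ 2) : 2 * bb S.card - 2 ≤ WW x c S := by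
  have hE : 0 ≤ EE x S := sum_nonneg fun i _ => sum_nonneg fun j _ => H.nonneg i j
  have hC : 0 ≤ ∑ i ∈ S, c i := sum_nonneg fun i _ => H.c0 i
  have h3 : S.card = 0 ∨ S.card = 1 ∨ S.card = 2 := by omega
  unfold WW
  rcases h3 with h | h | h
  · rw [h]; simp [bb, zz]; omega
  · rw [h]; simp [bb, zz]; omega
  · rw [h]
    have e2 : bb 2 = 3 := by simp [bb, zz]
    rw [e2]
    obtain ⟨a, b, hab, rfl⟩ := card_eq_two.1 h
    rw [sum_pair hab] at hC ⊢
    have hEE : EE x {a, b} = 2 * x a b := by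
      simp only [EE, sum_pair hab, H.diag, H.symm b a]; ring
    rw [hEE]
    have ha := H.c0 a
    have hb := H.c0 b
    have hx := H.hx a b hab
    by_contra hlt
    have hx0 := H.nonneg a b
    have : (c a = 0 ∧ c b = 0) ∨ (c a = 0 ∧ c b = 1) ∨ (c a = 1 ∧ c b = 0) := by omega
    rcases this with ⟨h1, h2⟩ | ⟨h1, h2⟩ | ⟨h1, h2⟩
    · rw [H.t0 a h1, H.t0 b h2, G_self] at hx; omega
    · rw [H.t0 a h1, G_symm, P1_G0 (H.t1 b h2)] at hx; omega
    · rw [H.t0 b h2, P1_G0 (H.t1 a h1)] at hx; omega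

theorem stage2b (H : TH x c τ) (S : Finset ℕ) : 2 * bb S.card - 2 ≤ WW x c S := by
  induction hn : S.card using Nat.strong_induction_on generalizing S with
  | _ n ih =>
  subst hn
  have ih' : ∀ S' : Finset ℕ, S'.card < S.card → 2 * bb S'.card - 2 ≤ WW x c S' :=
    fun S' h => ih _ h S' rfl
  by_cases hsm : S.card ≤ 2
  · exact st_small H S hsm
  by_contra hlt
  have hK := kleitman H.toKH S
  set C := ∑ i ∈ S, c i with hC
  have hC2 : 2 * C + 4 ≤ 3 * S.card := by
    unfold WW bb at hlt
    omega
  have hstep : ∀ i ∈ S, ∀ j ∈ S, i ≠ j → ¬ (3 + G (τ i) (τ j) - c i - c j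
      ≤ ∑ l ∈ S, (G (τ i) (τ l) + G (τ j) (τ l) - 4)) := by
    intro i hi j hj hij h
    exact hlt (step H.toSH ih' hi hj hij h)
  have hlin : ∀ α β : ℤ, ∑ l ∈ S, (α - β * c l) = α * S.card - β * C := by
    intro α β
    rw [sum_sub_distrib, ← mul_sum, sum_const, nsmul_eq_mul]; ring
  set P0 := S.filter (fun i => c i = 0) with hP0
  set Pq := S.filter (fun i => c i = 1) with hPq
  by_cases hp0 : 2 ≤ P0.card
  · obtain ⟨i, hi, j, hj, hij⟩ := one_lt_card.1 (show 1 < P0.card by omega)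
    simp only [hP0, mem_filter] at hi hj
    have ti := H.t0 i hi.2
    have tj := H.t0 j hj.2
    by_cases hl : ∃ l ∈ S, c l = 3 ∧ G 0 (τ l) = 0
    · obtain ⟨l, hlS, hl3, hl0⟩ := hl
      have hil : i ≠ l := by rintro rfl; omega
      apply hstep i hi.1 l hlS hil
      rw [ti, hl0, hi.2, hl3]
      have : ∑ _m ∈ S, (0 : ℤ) ≤ ∑ m ∈ S, (G 0 (τ m) + G (τ l) (τ m) - 4) := by
        apply sum_le_sum
        intro m _
        have := G_tri (s := 0) (t := τ l) (u := τ m) (by rw [← ti]; exact H.hw _ _)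
          (by rw [← ti]; exact H.hw _ _)
        omega
      simpa using this
    · push Not at hl
      apply hstep i hi.1 j hj.1 hij
      have : ∑ l ∈ S, (4 - 2 * c l) ≤ ∑ m ∈ S, (G (τ i) (τ m) + G (τ j) (τ m) - 4) := by
        apply sum_le_sum
        intro m hm
        rw [ti, tj]
        have h0 := H.c0 m
        have hg := G_nonneg 0 (τ m)
        have : c m = 0 ∨ c m = 1 ∨ c m = 2 ∨ c m = 3 ∨ 4 ≤ c m := by omega
        rcases this with h | h | h | h | h
        · rw [H.t0 m h, G_self]; omega
        · have := P1_G0 (H.t1 m h)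
          rw [G_symm] at this; omega
        · have := (H.t2 m h).1
          rw [G_symm] at this; omega
        · have := hl m hm h; omega
        · omega
      rw [hlin] at this
      rw [ti, tj] at this ⊢
      rw [G_self]
      omega
  · -- at most one element of weight zero
    set T := P1.filter (fun s => ∃ i ∈ Pq, τ i = s) with hT
    have hTP : T ⊆ P1 := filter_subset _ _
    have hTk : T.card ≤ 6 := (card_le_card hTP).trans (by decide)
    set D : ℕ → ℤ := fun s => ∑ l ∈ S, (G (τ l) s - 2) with hD
    have hP0S : P0.card ≤ S.card := card_le_card (filter_subset _ _)
    -- many elements of weight one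
    have hPc : 2 ≤ Pq.card := by
      by_contra hp
      have : ∑ i ∈ S, (2 - (if c i = 1 then 1 else 0) - 2 * (if c i = 0 then 1 else 0) : ℤ) ≤ C := by
        apply sum_le_sum
        intro i _
        have := H.c0 i
        split_ifs <;> omega
      rw [sum_sub_distrib, ← mul_sum, sum_sub_distrib, sum_boole, sum_boole, sum_const, nsmul_eq_mul]
        at this
      change _ - (Pq.card : ℤ) - 2 * (P0.card : ℤ) ≤ C at this
      omega
    have hDsum : (T.card : ℤ) + 2 ≤ ∑ s ∈ T, D s := by
      simp only [hD]
      rw [sum_comm]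
      have : ∑ l ∈ S, ((6 - 4 * c l) - (6 - (T.card : ℤ)) * (if c l = 0 then 1 else 0)) ≤
          ∑ l ∈ S, ∑ s ∈ T, (G (τ l) s - 2) := by
        apply sum_le_sum
        intro l hl
        have h0 := H.c0 l
        have : c l = 0 ∨ c l = 1 ∨ c l = 2 ∨ 3 ≤ c l := by omega
        rcases this with h | h | h | h
        · rw [H.t0 l h, sum_congr rfl (fun s hs => by
            rw [G_symm, P1_G0 (hTP hs)]), h]
          simp
        · have hτ : τ l ∈ T := by
            simp only [hT, mem_filter]
            exact ⟨H.t1 l h, l, by simp [hPq, hl, h], rfl⟩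
          rw [← add_sum_erase T _ hτ, G_self, sum_congr rfl (fun s hs => by
            rw [P1_G (H.t1 l h) (hTP (mem_of_mem_erase hs)) (ne_of_mem_erase hs).symm]), h]
          simp
        · have a := (H.t2 l h).2
          have b := neg_le hTP (τ l)
          rw [if_neg (by omega)]
          omega
        · have a := neg_ck _ (H.lt l)
          have b := neg_le hTP (τ l)
          rw [if_neg (by omega)]
          omega
      rw [sum_sub_distrib, hlin, ← mul_sum, sum_boole] at this
      change _ - _ * (P0.card : ℤ) ≤ _ at this
      have h01 : (P0.card : ℤ) ≤ 1 := by omega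
      have hT6 : (T.card : ℤ) ≤ 6 := by exact_mod_cast hTk
      have : (6 - (T.card : ℤ)) * P0.card ≤ 6 - T.card := by nlinarith
      linarith
    have hrep : ∀ s ∈ T, ∃ i ∈ S, c i = 1 ∧ τ i = s := by
      intro s hs
      simp only [hT, hPq, mem_filter] at hs
      obtain ⟨_, i, ⟨hi, hc⟩, rfl⟩ := hs
      exact ⟨i, hi, hc, rfl⟩
    have hDD : ∀ i j, ∑ l ∈ S, (G (τ i) (τ l) + G (τ j) (τ l) - 4) = D (τ i) + D (τ j) := by
      intro i j
      simp only [hD]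
      rw [← sum_add_distrib]
      apply sum_congr rfl
      intro l _
      rw [G_symm (τ i), G_symm (τ j)]; ring
    have hpair : ∀ s ∈ T, ∀ t ∈ T, s ≠ t → D s + D t ≤ 2 := by
      intro s hs t ht hst
      obtain ⟨i, hi, hci, rfl⟩ := hrep s hs
      obtain ⟨j, hj, hcj, rfl⟩ := hrep t ht
      have hij : i ≠ j := by rintro rfl; exact hst rfl
      have := hstep i hi j hj hij
      rw [hDD, hci, hcj, P1_G (H.t1 i hci) (H.t1 j hcj) hst] at this
      omega
    have hT1 : T.Nonempty := by
      obtain ⟨i, hi⟩ := card_pos.1 (show 0 < Pq.card by omega)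
      refine ⟨τ i, ?_⟩
      simp only [hT, mem_filter]
      exact ⟨H.t1 i (mem_filter.1 hi).2, i, hi, rfl⟩
    -- some D is at least two
    obtain ⟨s, hs, hDs⟩ : ∃ s ∈ T, 2 ≤ D s := by
      by_contra hcon
      push Not at hcon
      have : ∑ s ∈ T, D s ≤ ∑ _s ∈ T, (1 : ℤ) := sum_le_sum fun s hs => by
        have := hcon s hs; omega
      simp at this
      omega
    by_cases hk : T.card = 1
    · obtain ⟨s', hs'⟩ := card_eq_one.1 hk
      have hss : s = s' := by simpa [hs'] using hs
      rw [hs', sum_singleton, card_singleton] at hDsum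
      obtain ⟨i, hi, j, hj, hij⟩ := one_lt_card.1 (show 1 < Pq.card by omega)
      have hst : ∀ i ∈ Pq, τ i = s' := by
        intro i hi
        have : τ i ∈ T := by
          simp only [hT, mem_filter]
          exact ⟨H.t1 i (mem_filter.1 hi).2, i, hi, rfl⟩
        simpa [hs'] using this
      have hi' := mem_filter.1 hi
      have hj' := mem_filter.1 hj
      have := hstep i hi'.1 j hj'.1 hij
      rw [hDD, hi'.2, hj'.2, hst i hi, hst j hj, G_self] at this
      push_cast at hDsum
      omega
    · have hk2 : 2 ≤ T.card := by have := card_pos.2 hT1; omega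
      rw [← add_sum_erase T D hs] at hDsum
      have hle : ∑ t ∈ T.erase s, D t ≤ ∑ _t ∈ T.erase s, (2 - D s) := sum_le_sum fun t ht => by
        have := hpair s hs t (mem_of_mem_erase ht) (ne_of_mem_erase ht).symm
        omega
      rw [sum_const, card_erase_of_mem hs, nsmul_eq_mul] at hle
      have h1 : (1 : ℤ) ≤ ((T.card - 1 : ℕ) : ℤ) := by omega
      have h2 : (2 : ℤ) ≤ T.card := by exact_mod_cast hk2
      nlinarith

end stage2b

section combine
open Finset
variable (m k ν M : ℕ → ℕ → ℕ → Bool)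

def pb (s : ℕ) : Bool := s.testBit 0 ^^ (s.testBit 1 ^^ (s.testBit 2 ^^ (s.testBit 3 ^^
  (s.testBit 4 ^^ s.testBit 5))))

theorem pb_xor (s t : ℕ) : pb (s ^^^ t) = (pb s ^^ pb t) := by
  simp only [pb, Nat.testBit_xor]
  have x4 : ∀ a b c d : Bool, ((a ^^ b) ^^ (c ^^ d)) = ((a ^^ c) ^^ (b ^^ d)) := by decide
  conv_rhs => rw [x4, x4 (s.testBit 1), x4 (s.testBit 2), x4 (s.testBit 3), x4 (s.testBit 4)]

theorem pb_lin : ∀ cs bs, (∀ c ∈ cs, pb c = true) → bs.length = cs.length →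
    pb (lin cs bs) = decide (wt bs % 2 = 1)
  | [], [], _, _ => by simp [lin, wt, pb]
  | c :: cs, b :: bs, h, hl => by
    have ih := pb_lin cs bs (fun c hc => h c (by simp [hc])) (by simpa using hl)
    simp only [lin, wt, pb_xor, ih]
    have hc := h c (by simp)
    cases b
    · simp [pb]
    · rcases Nat.mod_two_eq_zero_or_one (wt bs) with h | h
      · simp [hc, h, Nat.add_mod]
      · simp [hc, h, Nat.add_mod]

attribute [local irreducible] wt xw yw uw lin tau F

def xx (i j : ℕ) : ℤ := if i = j then 0 else (wt (xw m k i j) : ℤ)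
def cc (i : ℕ) : ℤ := (wt (yw m ν M i) : ℤ)

theorem F_ck : chk (fun s w => decide (F s ≤ w)) colX 3 0 0 = true := by decide +kernel
theorem F_le : ∀ s < 64, F s ≤ 4 := by decide +kernel

theorem lin_colX_lt (bs : List Bool) : lin colX bs < 64 := lin_lt 6 _ (by decide) _

theorem F_le_wt (i j : ℕ) : F (63 ^^^ tau m ν M i ^^^ tau m ν M j) ≤ wt (xw m k i j) := by
  rw [← linX_eq m k]
  by_cases h : wt (xw m k i j) ≤ 3
  · have := chk_sound _ _ _ _ _ F_ck (xw m k i j) (by simp [xw_length, colX]) h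
    simpa using this
  · have := F_le _ (lin_colX_lt (xw m k i j))
    omega

theorem tau_w (i j : ℕ) : tau m ν M i / 64 = tau m ν M j / 64 := by
  have h := lin_colX_lt (xw m m i j)
  rw [linX_eq m m ν M] at h
  have h2 : (63 ^^^ tau m ν M i ^^^ tau m ν M j) / 2 ^ 6 = 0 := Nat.div_eq_of_lt h
  rw [Nat.xor_div_two_pow, Nat.xor_div_two_pow] at h2
  norm_num at h2
  exact h2

theorem KH_xx (ν M : ℕ → ℕ → ℕ → Bool) : KH (xx m k) where
  symm i j := by
    unfold xx
    by_cases h : i = j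
    · simp [h]
    · rw [if_neg h, if_neg (Ne.symm h), wt_symm]
  diag i := by simp [xx]
  nonneg i j := by unfold xx; split_ifs <;> simp
  par := by
    refine ⟨fun i => (pb (tau m ν M i)).toNat, ?_⟩
    intro i j hij
    have h := pb_lin colX (xw m k i j) (by decide) (by simp [xw_length, colX])
    rw [linX_eq m k ν M, pb_xor, pb_xor] at h
    simp only [xx, if_neg hij]
    have h63 : pb 63 = false := by decide
    rw [h63] at h
    revert h
    cases pb (tau m ν M i) <;> cases pb (tau m ν M j) <;> simp <;> omega
  tri i j l hij hil hjl := by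
    have h1 := F_le_wt m k ν M i j
    have h2 := F_le_wt m k ν M i l
    have h3 := F_le_wt m k ν M j l
    have := G_tri (tau_w m ν M i j) (tau_w m ν M i l)
    simp only [xx, if_neg hij, if_neg hil, if_neg hjl]
    unfold G at this
    omega
  cA i j hij hj h1 h2 := by
    refine arrA m k hij (fun a => ?_) (fun a b hab => ?_)
    · have := h1 a
      rw [xx, if_neg (hij a)] at this
      exact_mod_cast this
    · have := h2 a b hab
      rw [xx, if_neg (fun h => hab (hj h))] at this
      exact_mod_cast this
  cB i e j hie hij hej hj h1 he h2 h3 := by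
    refine arrB m k hie hij hej (fun a => ?_) (fun a => ?_) ?_ (fun a b hab => ?_)
    · have := h1 a
      rw [xx, if_neg (hij a)] at this
      exact_mod_cast this
    · have := he a
      rw [xx, if_neg (hej a)] at this
      exact_mod_cast this
    · rw [xx, if_neg hie] at h2
      exact_mod_cast h2
    · have := h3 a b hab
      rw [xx, if_neg (fun h => hab (hj h))] at this
      exact_mod_cast this

theorem SH_xx : SH (xx m k) (cc m ν M) (tau m ν M) where
  toKH := KH_xx m k ν M
  hx i j hij := by
    rw [xx, if_neg hij]; unfold G
    exact_mod_cast F_le_wt m k ν M i j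
  c0 i := by simp [cc]
  hw := tau_w m ν M

theorem ckQ : chk (fun s w => decide (s < 64) || (w != 0 && (w != 1 || decide (s ∈ Q1)))) colY 1 0 0 = true := by
  decide +kernel

theorem ckP : chk (fun s w => decide (64 ≤ s) || ((w != 0 || s == 0) && (w != 1 || decide (s ∈ P1)) &&
    (w != 2 || (decide (2 ≤ F (63 ^^^ s ^^^ 0)) && decide (neg s ≤ 2))))) colY 2 0 0 = true := by
  decide +kernel

theorem main_WW (n : ℕ) (hn : 0 < n) : 2 * bb n ≤ WW (xx m k) (cc m ν M) (range n) + 2 * wt (uw M) := by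
  by_cases hw : tau m ν M 0 < 64
  · have h1 := u_pos m ν M 0 hw
    have hlt : ∀ i, tau m ν M i < 64 := by
      intro i
      have := tau_w m ν M 0 i
      omega
    have hck : ∀ i, wt (yw m ν M i) ≤ 2 → _ := fun i h =>
      chk_sound _ _ _ _ _ ckP (yw m ν M i) (by simp [yw_length, colY]) h
    simp only [Nat.zero_xor, zero_add] at hck
    have H : TH (xx m k) (cc m ν M) (tau m ν M) :=
      { toSH := SH_xx m k ν M
        lt := hlt
        t0 := by
          intro i h
          have h : wt (yw m ν M i) = 0 := by unfold cc at h; exact_mod_cast h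
          have := hck i (by omega)
          rw [h] at this
          have hl := hlt i
          unfold tau at hl ⊢
          simpa [Nat.not_le.2 hl] using this
        t1 := by
          intro i h
          have h : wt (yw m ν M i) = 1 := by unfold cc at h; exact_mod_cast h
          have := hck i (by omega)
          rw [h] at this
          have hl := hlt i
          unfold tau at hl ⊢
          simpa [Nat.not_le.2 hl] using this
        t2 := by
          intro i h
          have h : wt (yw m ν M i) = 2 := by unfold cc at h; exact_mod_cast h
          have := hck i (by omega)
          rw [h] at this
          have hl := hlt i
          unfold tau at hl ⊢
          unfold G
          simpa [Nat.not_le.2 hl] using this }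
    have := stage2b H (range n)
    rw [card_range] at this
    omega
  · have hge : ∀ i, ¬ tau m ν M i < 64 := by
      intro i
      have := tau_w m ν M 0 i
      omega
    have hck : ∀ i, wt (yw m ν M i) ≤ 1 → _ := fun i h =>
      chk_sound _ _ _ _ _ ckQ (yw m ν M i) (by simp [yw_length, colY]) h
    simp only [Nat.zero_xor, zero_add] at hck
    have := stage2a (SH_xx m k ν M) (by
      intro i
      by_contra h
      have h : wt (yw m ν M i) = 0 := by unfold cc at h; omega
      have := hck i (by omega)
      rw [h] at this
      have hl := hge i
      unfold tau at hl
      simp [hl] at this) (by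
      intro i h
      have h : wt (yw m ν M i) = 1 := by unfold cc at h; exact_mod_cast h
      have := hck i (by omega)
      rw [h] at this
      have hl := hge i
      unfold tau at hl ⊢
      simpa [hl] using this) (range n)
    rw [card_range] at this
    omega

theorem EE_range (n : ℕ) : EE (xx m k) (range n) =
    2 * ∑ j ∈ range n, ∑ i ∈ range j, (wt (xw m k i j) : ℤ) := by
  have H := KH_xx m k m m
  induction n with
  | zero => simp [EE]
  | succ n ih =>
    rw [range_add_one, EE_insert H.symm H.diag (by simp), ih, sum_insert (by simp), mul_add, add_comm]
    congr 2
    apply sum_congr rfl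
    intro i hi
    rw [H.symm, xx, if_neg (by have := mem_range.1 hi; omega)]

theorem main_comb (n : ℕ) (hn : 0 < n) : 2 * 2 * (n / 2) * ((n - 1) / 2) + 3 * n / 2 ≤
    wt (uw M) + ∑ i ∈ range n, wt (yw m ν M i) + ∑ j ∈ range n, ∑ i ∈ range j, wt (xw m k i j) := by
  have h := main_WW m k ν M n hn
  rw [WW, EE_range] at h
  unfold bb zz cc at h
  zify
  push_cast at h ⊢
  linarith

end combine

theorem exists_lift {A : Type} [TopologicalSpace A] [SimplyConnectedSpace A]
    [LocallyPathConnectedSpace A] (a₀ : A) (F : A → ℂ) (hF : Continuous F) (h0 : ∀ a, F a ≠ 0) :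
    ∃ L : A → ℂ, Continuous L ∧ ∀ a, Complex.exp (L a) = F a := by
  let f : C(A, {z : ℂ // z ≠ 0}) := ⟨fun a => ⟨F a, h0 a⟩, by fun_prop⟩
  obtain ⟨L, ⟨_, hL⟩, _⟩ := Complex.isCoveringMap_exp.existsUnique_continuousMap_lifts f a₀
    (Complex.log (F a₀)) (Subtype.ext (Complex.exp_log (h0 a₀)))
  exact ⟨L, L.continuous, fun a => congrArg Subtype.val (congrFun hL a)⟩

theorem lift_unique (g₁ g₂ : ℝ → ℂ) (h₁ : Continuous g₁) (h₂ : Continuous g₂) (K : ℂ)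
    (h : ∀ t, Complex.exp (g₁ t) = K * Complex.exp (g₂ t)) : g₁ 1 - g₁ 0 = g₂ 1 - g₂ 0 := by
  have := Complex.isCoveringMap_exp.const_of_comp (g := fun t => g₁ t - g₂ t) (h₁.sub h₂) (by
    intro a a'
    apply Subtype.ext
    simp only [Complex.exp_sub, h]
    field_simp [Complex.exp_ne_zero]) 1 0
  linear_combination this

/-- `θ` is the (complex) logarithmic increment of `γ - v` on `[0,1]`. -/
def Winds (γ : ℝ → ℂ) (v θ : ℂ) : Prop :=
  ∃ L : ℝ → ℂ, Continuous L ∧ (∀ t, Complex.exp (L t) = γ t - v) ∧ L 1 - L 0 = θ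

theorem exists_winds (γ : ℝ → ℂ) (hγ : Continuous γ) (v : ℂ) (h : ∀ t, γ t ≠ v) :
    ∃ θ, Winds γ v θ := by
  obtain ⟨L, hL, h'⟩ := exists_lift (0:ℝ) (fun t => γ t - v) (by fun_prop)
    (fun t => sub_ne_zero.2 (h t))
  exact ⟨_, L, hL, h', rfl⟩

theorem winds_key (γ δ : ℝ → ℂ) (hγ : Continuous γ) (hδ : Continuous δ)
    (h : ∀ s t, γ s ≠ δ t) {θ₁ θ₂ θ₃ θ₄ : ℂ} (h₁ : Winds γ (δ 0) θ₁) (h₂ : Winds γ (δ 1) θ₂)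
    (h₃ : Winds δ (γ 0) θ₃) (h₄ : Winds δ (γ 1) θ₄) : θ₁ + θ₄ = θ₂ + θ₃ := by
  obtain ⟨L, hL, h'⟩ := exists_lift ((0:ℝ), (0:ℝ)) (fun p : ℝ × ℝ => γ p.1 - δ p.2) (by fun_prop)
    (fun t => sub_ne_zero.2 (h _ _))
  obtain ⟨L₁, c₁, e₁, rfl⟩ := h₁
  obtain ⟨L₂, c₂, e₂, rfl⟩ := h₂
  obtain ⟨L₃, c₃, e₃, rfl⟩ := h₃
  obtain ⟨L₄, c₄, e₄, rfl⟩ := h₄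
  have u₁ := lift_unique L₁ (fun s => L (s, 0)) c₁ (by fun_prop) 1 (by
    intro t; simp only [e₁, h']; ring)
  have u₂ := lift_unique L₂ (fun s => L (s, 1)) c₂ (by fun_prop) 1 (by
    intro t; simp only [e₂, h']; ring)
  have u₃ := lift_unique L₃ (fun s => L (0, s)) c₃ (by fun_prop) (-1) (by
    intro t; simp only [e₃, h']; ring)
  have u₄ := lift_unique L₄ (fun s => L (1, s)) c₄ (by fun_prop) (-1) (by
    intro t; simp only [e₄, h']; ring)
  linear_combination u₁ + u₄ - u₂ - u₃

/-- A branch of `log (w - v)` depending on the order of ranks. -/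
noncomputable def Bl (o : Bool) (v w : ℂ) : ℂ :=
  if o then Complex.log (w - v) else Complex.log (v - w) + Real.pi * Complex.I

theorem exp_Bl (o : Bool) (v w : ℂ) (h : v ≠ w) : Complex.exp (Bl o v w) = w - v := by
  unfold Bl
  split_ifs
  · exact Complex.exp_log (sub_ne_zero.2 h.symm)
  · rw [Complex.exp_add, Complex.exp_log (sub_ne_zero.2 h), Complex.exp_pi_mul_I]; ring

theorem winds_int (γ : ℝ → ℂ) (v θ : ℂ) (h : ∀ t, γ t ≠ v) (o₀ o₁ : Bool) (hw : Winds γ v θ) :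
    ∃ N : ℤ, θ = Bl o₁ v (γ 1) - Bl o₀ v (γ 0) + N * (2 * Real.pi * Complex.I) := by
  obtain ⟨L, c, e, rfl⟩ := hw
  have e0 := e 0
  have e1 := e 1
  rw [← exp_Bl o₀ v (γ 0) (h 0).symm, Complex.exp_eq_exp_iff_exists_int] at e0
  rw [← exp_Bl o₁ v (γ 1) (h 1).symm, Complex.exp_eq_exp_iff_exists_int] at e1
  obtain ⟨p, hp⟩ := e0
  obtain ⟨q, hq⟩ := e1
  refine ⟨q - p, ?_⟩
  rw [hp, hq]; push_cast; ring

theorem Bl_swap (o : Bool) (v w : ℂ) :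
    Bl o v w - Bl (!o) w v = (1 - 2 * (if o then 1 else 0)) * (Real.pi * Complex.I) := by
  cases o <;> simp [Bl]; ring

theorem parity_key (γ δ : ℝ → ℂ) (hγ : Continuous γ) (hδ : Continuous δ)
    (h : ∀ s t, γ s ≠ δ t) (oac ocb obd oda : Bool) {θ₁ θ₂ θ₃ θ₄ : ℂ} {N₁ N₂ N₃ N₄ : ℤ}
    (h₁ : Winds γ (δ 0) θ₁) (h₂ : Winds γ (δ 1) θ₂)
    (h₃ : Winds δ (γ 0) θ₃) (h₄ : Winds δ (γ 1) θ₄)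
    (k₁ : θ₁ = Bl ocb (δ 0) (γ 1) - Bl (!oac) (δ 0) (γ 0) + N₁ * (2 * Real.pi * Complex.I))
    (k₂ : θ₂ = Bl (!obd) (δ 1) (γ 1) - Bl oda (δ 1) (γ 0) + N₂ * (2 * Real.pi * Complex.I))
    (k₃ : θ₃ = Bl (!oda) (γ 0) (δ 1) - Bl oac (γ 0) (δ 0) + N₃ * (2 * Real.pi * Complex.I))
    (k₄ : θ₄ = Bl obd (γ 1) (δ 1) - Bl (!ocb) (γ 1) (δ 0) + N₄ * (2 * Real.pi * Complex.I)) :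
    (oac ^^ (ocb ^^ (obd ^^ (oda ^^ (N₁.bodd ^^ (N₂.bodd ^^ (N₃.bodd ^^ N₄.bodd))))))) = false := by
  have key := winds_key γ δ hγ hδ h h₁ h₂ h₃ h₄
  have s₁ := Bl_swap ocb (δ 0) (γ 1)
  have s₂ := Bl_swap oac (γ 0) (δ 0)
  have s₃ := Bl_swap obd (γ 1) (δ 1)
  have s₄ := Bl_swap oda (δ 1) (γ 0)
  have hpi : (Real.pi * Complex.I : ℂ) ≠ 0 := by simp [Real.pi_ne_zero]
  have hC : (4 - 2 * (if ocb then 1 else 0) - 2 * (if oac then 1 else 0) -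
      2 * (if obd then 1 else 0) - 2 * (if oda then 1 else 0) + 2 * (N₁ + N₄ - N₂ - N₃) : ℂ) = 0 := by
    apply (mul_eq_zero.1 _).resolve_right hpi
    rw [k₁, k₂, k₃, k₄] at key
    linear_combination key - s₁ - s₂ - s₃ - s₄
  have hZ : (4 - 2 * (if ocb then 1 else 0) - 2 * (if oac then 1 else 0) -
      2 * (if obd then 1 else 0) - 2 * (if oda then 1 else 0) + 2 * (N₁ + N₄ - N₂ - N₃) : ℤ) = 0 := by
    have : ∀ b : Bool, ((if b then 1 else 0 : ℤ) : ℂ) = if b then 1 else 0 := by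
      intro b; cases b <;> simp
    rw [← this, ← this, ← this, ← this] at hC
    exact_mod_cast hC
  have hb : ((if ocb then 1 else 0) + (if oac then 1 else 0) +
      (if obd then 1 else 0) + (if oda then 1 else 0) + (N₁ + N₄ + N₂ + N₃) : ℤ)
      = 2 * (1 + N₁ + N₄) := by linarith
  have hb' := congrArg Int.bodd hb
  have hi : ∀ b : Bool, Int.bodd (if b then 1 else 0) = b := by decide
  simp only [Int.bodd_add, Int.bodd_mul, hi] at hb'
  revert hb'
  generalize N₁.bodd = x1
  generalize N₂.bodd = x2
  generalize N₃.bodd = x3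
  generalize N₄.bodd = x4
  clear k₁ k₂ k₃ k₄ s₁ s₂ s₃ s₄ hC hZ hb key
  revert oac ocb obd oda x1 x2 x3 x4
  decide

/-- The plane as the complex numbers. -/
def toC (p : ℝ × ℝ) : ℂ := ⟨p.1, p.2⟩

theorem toC_inj : Function.Injective toC := by
  intro p q h
  have := Complex.ext_iff.1 h
  exact Prod.ext this.1 this.2

theorem continuous_toC : Continuous toC := by
  have : toC = fun p : ℝ × ℝ => (p.1 : ℂ) + p.2 * Complex.I := by
    funext p; apply Complex.ext <;> simp [toC]
  rw [this]; fun_prop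

section
variable {W : Type} {G : SimpleGraph W} (D : Drawing G)

/-- The arc as a curve on all of `ℝ`. -/
noncomputable def crv (a b : W) (t : ℝ) : ℂ :=
  toC (D.arc a b (Set.projIcc (0:ℝ) 1 zero_le_one t))

theorem crv_cont {a b : W} (h : G.Adj a b) : Continuous (crv D a b) := by
  have h1 := (continuousOn_iff_continuous_domRestrict.1 (D.arc_cont h))
  exact continuous_toC.comp (h1.comp (continuous_projIcc (h := zero_le_one)))

theorem crv_zero {a b : W} (h : G.Adj a b) : crv D a b 0 = toC (D.pos a) := by
  simp [crv, D.arc_zero h]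

theorem crv_one {a b : W} (h : G.Adj a b) : crv D a b 1 = toC (D.pos b) := by
  simp [crv, D.arc_one h]

theorem crv_ne {a b v : W} (h : G.Adj a b) (ha : v ≠ a) (hb : v ≠ b) (t : ℝ) :
    crv D a b t ≠ toC (D.pos v) := by
  intro he
  exact D.arc_avoid h v ha hb ⟨_, (Set.projIcc (0:ℝ) 1 zero_le_one t).2, toC_inj he⟩

theorem common_crossing {a b c d : W} (h : G.Adj a b) (h' : G.Adj c d) (hac : a ≠ c)
    (had : a ≠ d) (hbc : b ≠ c) (hbd : b ≠ d) (s t : ℝ) (he : crv D a b s = crv D c d t) :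
    ∃ p, D.IsCrossing s(a, b) s(c, d) p := by
  have hp := toC_inj he
  refine ⟨_, h, h', ?_, ⟨a, b, rfl, h, _, (Set.projIcc (0:ℝ) 1 zero_le_one s).2, rfl⟩,
    ⟨c, d, rfl, h', _, (Set.projIcc (0:ℝ) 1 zero_le_one t).2, hp.symm⟩, ?_, ?_⟩
  · simp [hac, had]
  · rintro ⟨v, hv, e⟩
    have e' : toC (D.arc a b (Set.projIcc (0:ℝ) 1 zero_le_one s)) = toC (D.pos v) := congrArg _ e
    rcases Sym2.mem_iff.1 hv with rfl | rfl
    · exact crv_ne D h' hac had t (he.symm.trans e')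
    · exact crv_ne D h' hbc hbd t (he.symm.trans e')
  · rintro ⟨v, hv, e⟩
    have e' : toC (D.arc a b (Set.projIcc (0:ℝ) 1 zero_le_one s)) = toC (D.pos v) := congrArg _ e
    rcases Sym2.mem_iff.1 hv with rfl | rfl
    · exact crv_ne D h hac.symm hbc.symm s e'
    · exact crv_ne D h had.symm hbd.symm s e'

theorem exists_N (r : W → ℕ) (hr : Function.Injective r) :
    ∃ N : W → W → W → Bool, ∀ a b c d, G.Adj a b → G.Adj c d → a ≠ c → a ≠ d → b ≠ c → b ≠ d →
      (decide (r a < r c) ^^ (decide (r c < r b) ^^ (decide (r b < r d) ^^ (decide (r d < r a) ^^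
        (N a b c ^^ (N a b d ^^ (N c d a ^^ N c d b))))))) = true →
      ∃ p, D.IsCrossing s(a, b) s(c, d) p := by
  have hex : ∀ a b v, ∃ N : ℤ, G.Adj a b → v ≠ a → v ≠ b →
      ∃ θ, Winds (crv D a b) (toC (D.pos v)) θ ∧
        θ = Bl (decide (r v < r b)) (toC (D.pos v)) (toC (D.pos b)) -
          Bl (decide (r v < r a)) (toC (D.pos v)) (toC (D.pos a)) +
            N * (2 * Real.pi * Complex.I) := by
    intro a b v
    by_cases h : G.Adj a b ∧ v ≠ a ∧ v ≠ b
    · obtain ⟨h, ha, hb⟩ := h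
      obtain ⟨θ, hθ⟩ := exists_winds _ (crv_cont D h) _ (crv_ne D h ha hb)
      obtain ⟨N, hN⟩ := winds_int _ _ _ (crv_ne D h ha hb) (decide (r v < r a))
        (decide (r v < r b)) hθ
      rw [crv_zero D h, crv_one D h] at hN
      exact ⟨N, fun _ _ _ => ⟨θ, hθ, hN⟩⟩
    · exact ⟨0, fun h1 h2 h3 => absurd ⟨h1, h2, h3⟩ h⟩
  choose N hN using hex
  refine ⟨fun a b v => (N a b v).bodd, fun a b c d h h' hac had hbc hbd he => ?_⟩
  by_contra hno
  have hdis : ∀ s t, crv D a b s ≠ crv D c d t := fun s t hst =>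
    hno (common_crossing D h h' hac had hbc hbd s t hst)
  have flip : ∀ v w : W, v ≠ w → decide (r v < r w) = !decide (r w < r v) := by
    intro v w hvw
    have := hr.ne hvw
    by_cases h1 : r v < r w
    · simp [h1, h1.le]
    · have h2 : r w < r v := by omega
      simp [h1, h2]
  obtain ⟨θ₁, w₁, k₁⟩ := hN a b c h hac.symm hbc.symm
  obtain ⟨θ₂, w₂, k₂⟩ := hN a b d h had.symm hbd.symm
  obtain ⟨θ₃, w₃, k₃⟩ := hN c d a h' hac had
  obtain ⟨θ₄, w₄, k₄⟩ := hN c d b h' hbc hbd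
  rw [flip c a hac.symm] at k₁
  rw [flip d b hbd.symm] at k₂
  rw [flip a d had] at k₃
  rw [flip b c hbc] at k₄
  have key := parity_key (crv D a b) (crv D c d) (crv_cont D h) (crv_cont D h') hdis
    (decide (r a < r c)) (decide (r c < r b)) (decide (r b < r d)) (decide (r d < r a))
    (θ₁ := θ₁) (θ₂ := θ₂) (θ₃ := θ₃) (θ₄ := θ₄)
    (by rwa [crv_zero D h']) (by rwa [crv_one D h']) (by rwa [crv_zero D h])
    (by rwa [crv_one D h]) (by rw [crv_zero D h', crv_zero D h, crv_one D h]; exact k₁)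
    (by rw [crv_one D h', crv_zero D h, crv_one D h]; exact k₂)
    (by rw [crv_zero D h', crv_zero D h, crv_one D h']; exact k₃)
    (by rw [crv_zero D h', crv_one D h, crv_one D h']; exact k₄)
  rw [key] at he
  exact Bool.false_ne_true he
end

section
variable {n : ℕ}

/-- Vertex type of `K_{1,1,3,n}`. -/
abbrev VV (n : ℕ) : Type := Σ i : Fin 4, ![Fin 1, Fin 1, Fin 3, Fin n] i

/-- Rank of a vertex. -/
def rk : VV n → ℕ
  | ⟨0, _⟩ => 0
  | ⟨1, _⟩ => 1
  | ⟨2, k⟩ => 2 + (show Fin 3 from k).val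
  | ⟨3, k⟩ => 5 + (show Fin n from k).val

/-- Class of a rank. -/
def cls (k : ℕ) : ℕ := if k = 0 then 0 else if k = 1 then 1 else if k < 5 then 2 else 3

theorem rk_lt (v : VV n) : rk v < 5 + n := by
  obtain ⟨i, x⟩ := v
  fin_cases i
  · show 0 < 5 + n; omega
  · show 1 < 5 + n; omega
  · show 2 + (show Fin 3 from x).val < 5 + n
    have := (show Fin 3 from x).2; omega
  · show 5 + (show Fin n from x).val < 5 + n
    have := (show Fin n from x).2; omega

theorem cls_rk (v : VV n) : cls (rk v) = v.1.val := by
  obtain ⟨i, x⟩ := v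
  fin_cases i
  · rfl
  · rfl
  · show cls (2 + (show Fin 3 from x).val) = 2
    have := (show Fin 3 from x).2
    unfold cls; split_ifs <;> omega
  · show cls (5 + (show Fin n from x).val) = 3
    unfold cls; split_ifs <;> omega

theorem rk_inj : Function.Injective (rk : VV n → ℕ) := by
  intro v w h
  have hc : v.1 = w.1 := Fin.ext (by rw [← cls_rk, ← cls_rk, h])
  obtain ⟨i, x⟩ := v
  obtain ⟨j, y⟩ := w
  dsimp only at hc
  subst hc
  congr 1
  fin_cases i
  · exact Subsingleton.elim (α := Fin 1) x y
  · exact Subsingleton.elim (α := Fin 1) x y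
  · have h' : 2 + (show Fin 3 from x).val = 2 + (show Fin 3 from y).val := h
    exact Fin.ext (n := 3) (Nat.add_left_cancel h')
  · have h' : 5 + (show Fin n from x).val = 5 + (show Fin n from y).val := h
    exact Fin.ext (n := n) (Nat.add_left_cancel h')

theorem adj_rk (v w : VV n) : (quadK 1 1 3 n).Adj v w ↔ cls (rk v) ≠ cls (rk w) := by
  rw [cls_rk, cls_rk]
  show v.1 ≠ w.1 ↔ _
  rw [Ne, Fin.ext_iff]

/-- Vertex of a given rank. -/
def vx (n k : ℕ) : VV n :=
  if k = 0 then ⟨0, (0 : Fin 1)⟩ else if k = 1 then ⟨1, (0 : Fin 1)⟩ else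
    if k < 5 then ⟨2, (Fin.ofNat 3 (k - 2) : Fin 3)⟩ else
      if h : k - 5 < n then ⟨3, (⟨k - 5, h⟩ : Fin n)⟩ else ⟨0, (0 : Fin 1)⟩

theorem rk_vx {k : ℕ} (h : k < 5 + n) : rk (vx n k) = k := by
  unfold vx
  split_ifs with h1 h2 h3 h4
  · exact h1.symm
  · exact h2.symm
  · show 2 + (Fin.ofNat 3 (k - 2)).val = k
    simp [Fin.ofNat]; omega
  · show 5 + (k - 5) = k
    omega
  · omega

instance : Finite (VV n) := Finite.of_injective (fun v : VV n => (⟨rk v, rk_lt v⟩ : Fin (5 + n)))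
  (fun _ _ h => rk_inj (Fin.ext_iff.1 h))
end

section
variable {W : Type} {G : SimpleGraph W} (D : Drawing G)

theorem isCrossing_symm {e f : Sym2 W} {p : ℝ × ℝ} (h : D.IsCrossing e f p) :
    D.IsCrossing f e p := by
  obtain ⟨h1, h2, h3, h4, h5, h6, h7⟩ := h
  exact ⟨h2, h1, h3.symm, h5, h4, h7, h6⟩

theorem crossings_injOn (hD : D.IsGood) (A B : Set (Sym2 W)) :
    Set.InjOn Prod.snd (D.crossings A B) := by
  rintro ⟨p, q⟩ ⟨e, f, hq, _, _, hc⟩ ⟨p', q'⟩ ⟨e', f', hq', _, _, hc'⟩ h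
  dsimp only at hq hq' h hc hc'
  subst h
  rw [hq, Sym2.eq_iff] at hq'
  have : p = p' := by
    rcases hq' with ⟨rfl, rfl⟩ | ⟨rfl, rfl⟩
    · exact hD.cross_once _ _ hc hc'
    · exact hD.cross_once _ _ hc (isCrossing_symm D hc')
  rw [this]

theorem card_le_crNum [Finite W] (hD : D.IsGood) (P : Finset (Sym2 (Sym2 W)))
    (hP : ∀ q ∈ P, ∃ e f p, q = s(e, f) ∧ D.IsCrossing e f p) : P.card ≤ D.crNum := by
  have hfin : (D.crossings G.edgeSet G.edgeSet).Finite :=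
    Set.Finite.of_injOn (Set.mapsTo_univ _ _) (crossings_injOn D hD _ _) Set.finite_univ
  have hsub : (P : Set (Sym2 (Sym2 W))) ⊆ Prod.snd '' D.crossings G.edgeSet G.edgeSet := by
    intro q hq
    obtain ⟨e, f, p, h, hc⟩ := hP q hq
    exact ⟨(p, q), ⟨e, f, h, hc.1, hc.2.1, hc⟩, rfl⟩
  have := Set.ncard_le_ncard hsub (hfin.image _)
  rw [Set.ncard_coe_finset] at this
  exact this.trans (Set.ncard_image_le hfin)
end

theorem wt_map {α : Type} [DecidableEq α] (f : α → Bool) : ∀ l : List α, l.Nodup →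
    wt (l.map f) = (l.toFinset.filter (fun x => f x = true)).card
  | [], _ => rfl
  | x :: l, h => by
    rw [List.nodup_cons] at h
    rw [List.map_cons, wt, wt_map f l h.2, List.toFinset_cons, Finset.filter_insert]
    cases hx : f x
    · simp
    · simp [h.1]; omega

/-- Index type for the forced crossings. -/
abbrev Idx : Type := (ℕ × ℕ) ⊕ ((Σ _ : ℕ, ℕ × ℕ × ℕ) ⊕ (Σ _ : ℕ, Σ _ : ℕ, ℕ × ℕ))

/-- The four ranks involved in a crossing. -/
def enc : Idx → ℕ × ℕ × ℕ × ℕ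
  | Sum.inl (c, d) => (0, c, 1, d)
  | Sum.inr (Sum.inl ⟨i, (a, b, c)⟩) => (5 + i, a, b, c)
  | Sum.inr (Sum.inr ⟨j, ⟨i, (a, b)⟩⟩) => (5 + i, a, 5 + j, b)

section
variable (m k ν M : ℕ → ℕ → ℕ → Bool) (n : ℕ)

/-- The index set of forced crossings. -/
def idxSet : Finset Idx :=
  (uent.toFinset.filter (fun p => Ub M p.1 p.2 = true)).disjSum
    (((Finset.range n).sigma
      (fun i => yent.toFinset.filter (fun p => Yb m ν M i p.1 p.2.1 p.2.2 = true))).disjSum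
    ((Finset.range n).sigma (fun j => (Finset.range j).sigma
      (fun i => offd.toFinset.filter (fun p => Xb m k i j p.1 p.2 = true)))))

theorem card_idxSet : (idxSet m k ν M n).card = 
    wt (uw M) + ∑ i ∈ Finset.range n, wt (yw m ν M i) +
      ∑ j ∈ Finset.range n, ∑ i ∈ Finset.range j, wt (xw m k i j) := by
  unfold idxSet uw ul yw yl xw xl
  rw [Finset.card_disjSum, Finset.card_disjSum, Finset.card_sigma, Finset.card_sigma, add_assoc]
  simp only [Finset.card_sigma]
  rw [wt_map _ _ (by decide)]
  simp only [wt_map _ yent (by decide), wt_map _ offd (by decide)]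
end

/-- Well-formedness of a code. -/
def okc (n : ℕ) : ℕ × ℕ × ℕ × ℕ → Prop := fun q =>
  (q.1 = 0 ∧ q.2.2.1 = 1 ∧ 2 ≤ q.2.1 ∧ q.2.1 < 5 ∧ 2 ≤ q.2.2.2 ∧ q.2.2.2 < 5 ∧ q.2.1 ≠ q.2.2.2) ∨
  (5 ≤ q.1 ∧ q.1 < 5 + n ∧ q.2.1 < 5 ∧ q.2.2.1 < q.2.2.2 ∧ q.2.2.2 < 5 ∧ q.2.2.1 < 2
    ∧ q.2.1 ≠ q.2.2.1 ∧ q.2.1 ≠ q.2.2.2) ∨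
  (5 ≤ q.1 ∧ q.1 < q.2.2.1 ∧ q.2.2.1 < 5 + n ∧ q.2.1 < 5 ∧ q.2.2.2 < 5 ∧ q.2.1 ≠ q.2.2.2)

theorem okc_enc {m k ν M : ℕ → ℕ → ℕ → Bool} {n : ℕ} {x : Idx} (h : x ∈ idxSet m k ν M n) :
    okc n (enc x) := by
  have hu : ∀ p ∈ uent.toFinset, 2 ≤ p.1 ∧ p.1 < 5 ∧ 2 ≤ p.2 ∧ p.2 < 5 ∧ p.1 ≠ p.2 := by decide
  have hy : ∀ p ∈ yent.toFinset, p.1 < 5 ∧ p.2.1 < p.2.2 ∧ p.2.2 < 5 ∧ p.2.1 < 2 ∧ p.1 ≠ p.2.1 ∧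
    p.1 ≠ p.2.2 := by decide
  have ho : ∀ p ∈ offd.toFinset, p.1 < 5 ∧ p.2 < 5 ∧ p.1 ≠ p.2 := by decide
  rcases x with ⟨c, d⟩ | ⟨i, a, b, c⟩ | ⟨j, i, a, b⟩
  · simp only [idxSet, Finset.inl_mem_disjSum, Finset.mem_filter] at h
    have := hu _ h.1
    exact Or.inl ⟨rfl, rfl, this⟩
  · simp only [idxSet, Finset.inr_mem_disjSum, Finset.inl_mem_disjSum, Finset.mem_filter,
      Finset.mem_sigma, Finset.mem_range] at h
    have := hy _ h.2.1
    right; left; simp only [enc] at *; omega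
  · simp only [idxSet, Finset.inr_mem_disjSum, Finset.mem_filter,
      Finset.mem_sigma, Finset.mem_range] at h
    have := ho _ h.2.2.1
    right; right; simp only [enc] at *; omega

theorem Y_small {m k ν M : ℕ → ℕ → ℕ → Bool} {n i a b c : ℕ}
    (h : Sum.inr (Sum.inl ⟨i, (a, b, c)⟩) ∈ idxSet m k ν M n) : b < 2 := by
  have hy : ∀ p ∈ yent.toFinset, p.2.1 < 2 := by decide
  simp only [idxSet, Finset.inr_mem_disjSum, Finset.inl_mem_disjSum, Finset.mem_filter,
      Finset.mem_sigma, Finset.mem_range] at h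
  exact hy _ h.2.1

theorem enc_inj {m k ν M : ℕ → ℕ → ℕ → Bool} {n : ℕ} {x y : Idx} (hx : x ∈ idxSet m k ν M n)
    (hy : y ∈ idxSet m k ν M n) (h : enc x = enc y) : x = y := by
  have h1 := okc_enc hx
  have h2 := okc_enc hy
  rcases x with ⟨c, d⟩ | ⟨i, a, b, c⟩ | ⟨j, i, a, b⟩ <;>
  rcases y with ⟨c', d'⟩ | ⟨i', a', b', c'⟩ | ⟨j', i', a', b'⟩ <;>
  simp only [enc, okc, Prod.mk.injEq] at h h1 h2
  · obtain ⟨_, rfl, _, rfl⟩ := h; rfl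
  · omega
  · omega
  · omega
  · obtain ⟨h, rfl, rfl, rfl⟩ := h
    obtain rfl : i = i' := by omega
    rfl
  · have := Y_small hx
    omega
  · omega
  · have := Y_small hy
    omega
  · obtain ⟨h, rfl, h', rfl⟩ := h
    obtain rfl : i = i' := by omega
    obtain rfl : j = j' := by omega
    rfl

theorem okc_inj {n : ℕ} {a b c d a' b' c' d' : ℕ} (h1 : okc n (a, b, c, d))
    (h2 : okc n (a', b', c', d')) (h : s(s(a, b), s(c, d)) = s(s(a', b'), s(c', d'))) :
    (a, b, c, d) = (a', b', c', d') := by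
  simp only [okc] at h1 h2
  simp only [Sym2.eq_iff] at h
  simp only [Prod.mk.injEq]
  rcases h with ⟨h | h, h' | h'⟩ | ⟨h | h, h' | h'⟩ <;> omega

theorem lower_bound (n : ℕ) (hn : 0 < n) (D : Drawing (quadK 1 1 3 n)) (hD : D.IsGood) :
    Z 5 n + 3 * n / 2 ≤ D.crNum := by
  classical
  obtain ⟨N, hN⟩ := exists_N D rk rk_inj
  have hN' : ∀ a b c d, a < 5 + n → b < 5 + n → c < 5 + n → d < 5 + n → cls a ≠ cls b →
      cls c ≠ cls d → a ≠ c → a ≠ d → b ≠ c → b ≠ d →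
      (decide (a < c) ^^ (decide (c < b) ^^ (decide (b < d) ^^ (decide (d < a) ^^
        (N (vx n a) (vx n b) (vx n c) ^^ (N (vx n a) (vx n b) (vx n d) ^^
        (N (vx n c) (vx n d) (vx n a) ^^ N (vx n c) (vx n d) (vx n b)))))))) = true →
      ∃ p, D.IsCrossing s(vx n a, vx n b) s(vx n c, vx n d) p := by
    intro a b c d ha hb hc hd h1 h2 h3 h4 h5 h6 h7
    have hne : ∀ u v, u < 5 + n → v < 5 + n → u ≠ v → vx n u ≠ vx n v := by
      intro u v hu hv huv he
      apply huv
      rw [← rk_vx hu, ← rk_vx hv, he]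
    apply hN
    · rw [adj_rk, rk_vx ha, rk_vx hb]; exact h1
    · rw [adj_rk, rk_vx hc, rk_vx hd]; exact h2
    · exact hne _ _ ha hc h3
    · exact hne _ _ ha hd h4
    · exact hne _ _ hb hc h5
    · exact hne _ _ hb hd h6
    · rw [rk_vx ha, rk_vx hb, rk_vx hc, rk_vx hd]; exact h7
  let m : ℕ → ℕ → ℕ → Bool := fun i a b => N (vx n (5 + i)) (vx n a) (vx n b)
  let k : ℕ → ℕ → ℕ → Bool := fun i j a => N (vx n (5 + i)) (vx n a) (vx n (5 + j))
  let ν : ℕ → ℕ → ℕ → Bool := fun i b c => N (vx n b) (vx n c) (vx n (5 + i))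
  let M : ℕ → ℕ → ℕ → Bool := fun b c a => N (vx n b) (vx n c) (vx n a)
  have hmain := main_comb m k ν M n hn
  have hZ : Z 5 n = 2 * 2 * (n / 2) * ((n - 1) / 2) := rfl
  rw [← card_idxSet, ← hZ] at hmain
  refine hmain.trans ?_
  let φ : Idx → Sym2 (Sym2 (VV n)) := fun x =>
    s(s(vx n (enc x).1, vx n (enc x).2.1), s(vx n (enc x).2.2.1, vx n (enc x).2.2.2))
  have hlt : ∀ {q : ℕ × ℕ × ℕ × ℕ}, okc n q →
      q.1 < 5 + n ∧ q.2.1 < 5 + n ∧ q.2.2.1 < 5 + n ∧ q.2.2.2 < 5 + n := by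
    intro q hq; simp only [okc] at hq; omega
  have hφ : Set.InjOn φ (idxSet m k ν M n) := by
    intro x hx y hy hxy
    apply enc_inj hx hy
    have o1 := okc_enc hx
    have o2 := okc_enc hy
    obtain ⟨a1, a2, a3, a4⟩ := hlt o1
    obtain ⟨b1, b2, b3, b4⟩ := hlt o2
    have := congrArg (Sym2.map (Sym2.map (rk : VV n → ℕ))) hxy
    simp only [φ, Sym2.map_mk, rk_vx, a1, a2, a3, a4, b1, b2, b3, b4] at this
    exact okc_inj o1 o2 this
  rw [← Finset.card_image_of_injOn hφ]
  apply card_le_crNum D hD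
  intro q hq
  obtain ⟨x, hx, rfl⟩ := Finset.mem_image.1 hq
  refine ⟨s(vx n (enc x).1, vx n (enc x).2.1), s(vx n (enc x).2.2.1, vx n (enc x).2.2.2), ?_⟩
  suffices ∃ p, D.IsCrossing s(vx n (enc x).1, vx n (enc x).2.1)
      s(vx n (enc x).2.2.1, vx n (enc x).2.2.2) p by
    obtain ⟨p, hp⟩ := this
    exact ⟨p, rfl, hp⟩
  have ok := okc_enc hx
  obtain ⟨l1, l2, l3, l4⟩ := hlt ok
  have c1 : cls (enc x).1 ≠ cls (enc x).2.1 := by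
    simp only [okc] at ok; unfold cls; split_ifs <;> omega
  have c2 : cls (enc x).2.2.1 ≠ cls (enc x).2.2.2 := by
    simp only [okc] at ok; unfold cls; split_ifs <;> omega
  have d1 : (enc x).1 ≠ (enc x).2.2.1 := by simp only [okc] at ok; omega
  have d2 : (enc x).1 ≠ (enc x).2.2.2 := by simp only [okc] at ok; omega
  have d3 : (enc x).2.1 ≠ (enc x).2.2.1 := by simp only [okc] at ok; omega
  have d4 : (enc x).2.1 ≠ (enc x).2.2.2 := by simp only [okc] at ok; omega
  rcases x with ⟨c, d⟩ | ⟨i, a, b, c⟩ | ⟨j, i, a, b⟩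
  · refine hN' 0 c 1 d l1 l2 l3 l4 c1 c2 d1 d2 d3 d4 ?_
    simp only [idxSet, Finset.inl_mem_disjSum, Finset.mem_filter] at hx
    have h := hx.2
    simp only [enc, Ub, okc] at h ok ⊢
    have e1 : decide (1 < c) = true := by simp; omega
    have e2 : decide (d < 0) = false := by simp
    rw [e1, e2]
    simpa using h
  · refine hN' (5 + i) a b c l1 l2 l3 l4 c1 c2 d1 d2 d3 d4 ?_
    have hb2 := Y_small hx
    simp only [idxSet, Finset.inr_mem_disjSum, Finset.inl_mem_disjSum, Finset.mem_filter,
      Finset.mem_sigma, Finset.mem_range] at hx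
    have h := hx.2.2
    simp only [enc, Yb, okc] at h ok ⊢
    have e1 : decide (5 + i < b) = false := by simp; omega
    have e2 : decide (c < 5 + i) = true := by simp; omega
    have e3 : decide (b < a ∧ a < c) = (decide (b < a) ^^ (decide (a < c) ^^ true)) := by
      by_cases h1 : b < a <;> by_cases h2 : a < c <;> simp [h1, h2] <;> omega
    rw [e3] at h
    rw [e1, e2]
    simpa [m, ν, M] using h
  · refine hN' (5 + i) a (5 + j) b l1 l2 l3 l4 c1 c2 d1 d2 d3 d4 ?_
    simp only [idxSet, Finset.inr_mem_disjSum, Finset.mem_filter,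
      Finset.mem_sigma, Finset.mem_range] at hx
    have h := hx.2.2.2
    simp only [enc, Xb, okc] at h ok ⊢
    have e1 : decide (5 + j < a) = false := by simp; omega
    have e2 : decide (b < 5 + i) = true := by simp; omega
    have e3 : decide (5 + i < 5 + j) = decide (i < j) := by simp
    rw [e1, e2, e3]
    refine Eq.trans ?_ h
    simp only [m, k]
    generalize N (vx n (5 + i)) (vx n a) (vx n (5 + j)) = x1
    generalize N (vx n (5 + i)) (vx n a) (vx n b) = x2
    generalize N (vx n (5 + j)) (vx n b) (vx n (5 + i)) = x3
    generalize N (vx n (5 + j)) (vx n b) (vx n a) = x4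
    generalize decide (i < j) = x5
    generalize decide (a < b) = x6
    revert x1 x2 x3 x4 x5 x6
    decide

section UpperGeometry

/-- First coordinate of the vertex of rank `k`. -/
noncomputable def Px (k : ℕ) : ℝ :=
  if k = 0 then -1 else if k = 1 then 2 else if k = 2 then -2 else if k = 3 then 1 else
    if k = 4 then 3 else 0

theorem Px0 : Px 0 = -1 := by simp [Px]
theorem Px1 : Px 1 = 2 := by simp [Px]
theorem Px2 : Px 2 = -2 := by simp [Px]
theorem Px3 : Px 3 = 1 := by simp [Px]
theorem Px4 : Px 4 = 3 := by simp [Px]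
theorem Px5 {k : ℕ} (h : 5 ≤ k) : Px k = 0 := by
  unfold Px; split_ifs <;> first | omega | rfl

/-- Second coordinate of the vertex of rank `k`. -/
noncomputable def Py (k : ℕ) : ℝ :=
  if 5 ≤ k then (if k % 2 = 0 then 2 ^ (k - 5) else -2 ^ (k - 5)) else 0

/-- The allowed pairs of ends for crossings between two spokes. -/
def ok4 (a c : ℕ) : Prop := (a = 2 ∧ c = 0) ∨ (a = 1 ∧ c = 3) ∨ (a = 4 ∧ c = 3) ∨ (a = 4 ∧ c = 1)

theorem TT_same {a c : ℕ} (ha : a < 5) (hc : c < 5) {u X : ℝ} (hu : 0 < u)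
    (h1 : 0 < X / Px a) (e : u * (1 - X / Px a) = u * (1 - X / Px c)) :
    a = c := by
  have e' : X / Px a = X / Px c := by
    have := mul_left_cancel₀ hu.ne' e
    linarith
  clear e
  interval_cases a <;> interval_cases c <;> first
    | rfl
    | (exfalso; simp only [Px0, Px1, Px2, Px3, Px4] at *; linarith)

theorem TT_lt {a c : ℕ} (ha : a < 5) (hc : c < 5) {u v X : ℝ} (hu : 0 < u) (huv : 2 * u ≤ v)
    (h1 : 0 < X / Px a) (h2 : X / Px a < 1) (h3 : 0 < X / Px c) (h4 : X / Px c < 1)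
    (e : u * (1 - X / Px a) = v * (1 - X / Px c)) :
    ok4 a c ∧ (a = 4 → c = 1 → 3 / 2 ≤ X) := by
  have h5 : 2 * u * (1 - X / Px c) ≤ u * (1 - X / Px a) := by
    rw [e]; exact mul_le_mul_of_nonneg_right huv (by linarith)
  have h6 : 2 * (1 - X / Px c) ≤ 1 - X / Px a := by
    by_contra hcon
    push Not at hcon
    nlinarith
  clear h5 e
  interval_cases a <;> interval_cases c <;> simp only [Px0, Px1, Px2, Px3, Px4] at * <;> first
    | (exfalso; linarith)
    | (refine ⟨by unfold ok4; simp, ?_⟩; intros; linarith)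

theorem T_xy {a : ℕ} (ha : a < 5) {u X : ℝ} (hu : 1 ≤ u)
    (h1 : 0 < X / Px a) (h2 : X / Px a < 1) (h3 : -1 < X) (h4 : X < 2)
    (e : u * (1 - X / Px a) = min ((X + 1) / 8) ((2 - X) / 4)) :
    a = 3 ∧ u * (1 - X / Px a) = (X + 1) / 8 := by
  have m1 := min_le_left ((X + 1) / 8) ((2 - X) / 4)
  have m2 := min_le_right ((X + 1) / 8) ((2 - X) / 4)
  have h5 : 1 - X / Px a ≤ u * (1 - X / Px a) := by nlinarith
  have e' : X ≤ 1 → min ((X + 1) / 8) ((2 - X) / 4) = (X + 1) / 8 := by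
    intro hx; apply min_eq_left; linarith
  interval_cases a <;> simp only [Px0, Px1, Px2, Px3, Px4] at * <;> first
    | (exfalso; linarith)
    | (refine ⟨trivial, ?_⟩; rw [e, e']; linarith)

theorem T_xz {a : ℕ} (ha : a < 5) {u H X : ℝ} (hu : 0 < u) (hH : 2 * u ≤ H)
    (h1 : 0 < X / Px a) (h2 : X / Px a < 1) (h3 : -1 < X) (h4 : X < 3)
    (e : u * (1 - X / Px a) = H * min (1 + X) (1 - X / 3)) :
    a = 2 ∧ u * (1 - X / Px a) = H * (1 + X) := by
  have m0 : 0 < min (1 + X) (1 - X / 3) := lt_min (by linarith) (by linarith)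
  have h5 : 2 * min (1 + X) (1 - X / 3) ≤ 1 - X / Px a := by
    by_contra hcon
    push Not at hcon
    nlinarith
  have e1 : X ≤ 0 → min (1 + X) (1 - X / 3) = 1 + X := by
    intro hx; apply min_eq_left; linarith
  have e2 : 0 ≤ X → min (1 + X) (1 - X / 3) = 1 - X / 3 := by
    intro hx; apply min_eq_right; linarith
  rcases le_total X 0 with hx | hx
  · rw [e1 hx] at e h5 m0
    clear e1 e2
    interval_cases a <;> simp only [Px0, Px1, Px2, Px3, Px4] at * <;> first
    | (exfalso; linarith)
    | (exact ⟨trivial, e⟩)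
  · rw [e2 hx] at e h5 m0
    clear e1 e2
    exfalso
    interval_cases a <;> simp only [Px0, Px1, Px2, Px3, Px4] at * <;> linarith

theorem T_yz {a : ℕ} (ha : a < 5) {u H X : ℝ} (hu : 0 < u) (hH : 2 * u ≤ H)
    (h1 : 0 < X / Px a) (h2 : X / Px a < 1) (h3 : -2 < X) (h4 : X < 2)
    (e : u * (1 - X / Px a) = H * (1 - |X| / 2)) :
    a = 4 ∧ u * (1 - X / Px a) = H * (1 - X / 2) := by
  have m0 : 0 < 1 - |X| / 2 := by
    have := abs_lt.2 ⟨h3, h4⟩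
    linarith
  have h5 : 2 * (1 - |X| / 2) ≤ 1 - X / Px a := by
    by_contra hcon
    push Not at hcon
    nlinarith
  rcases le_total X 0 with hx | hx
  · rw [abs_of_nonpos hx] at *
    exfalso
    interval_cases a <;> simp only [Px0, Px1, Px2, Px3, Px4] at * <;> linarith
  · rw [abs_of_nonneg hx] at *
    interval_cases a <;> simp only [Px0, Px1, Px2, Px3, Px4] at * <;> first
    | (exfalso; linarith)
    | (exact ⟨trivial, e⟩)

theorem xy_xz {H X : ℝ} (hH : 1 ≤ H) (h3 : -1 < X) (h4 : X < 2)
    (e : min ((X + 1) / 8) ((2 - X) / 4) = H * min (1 + X) (1 - X / 3)) : False := by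
  have m0 : 0 < min (1 + X) (1 - X / 3) := lt_min (by linarith) (by linarith)
  have m3 : min (1 + X) (1 - X / 3) ≤ H * min (1 + X) (1 - X / 3) := by nlinarith
  have m1 := min_le_left ((X + 1) / 8) ((2 - X) / 4)
  have m2 := min_le_right ((X + 1) / 8) ((2 - X) / 4)
  rcases le_total (1 + X) (1 - X / 3) with h | h
  · rw [min_eq_left h] at *; linarith
  · rw [min_eq_right h] at *; linarith
end UpperGeometry

section UpperGeometry2

/-- The function whose graph carries the edge between the ranks `a < b`. -/
noncomputable def fnL (n a b : ℕ) (X : ℝ) : ℝ :=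
  if 5 ≤ b then Py b * (1 - X / Px a) else
    if a = 0 ∧ b = 1 then min ((X + 1) / 8) ((2 - X) / 4) else
      if a = 0 ∧ b = 4 then 2 ^ n * min (1 + X) (1 - X / 3) else
        if a = 1 ∧ b = 2 then -(2 ^ n * (1 - |X| / 2)) else 0

/-- Interior points of the edge between the ranks `a < b`. -/
inductive Desc (n : ℕ) : ℕ → ℕ → ℝ → ℝ → Prop
  | up (a b : ℕ) (X Y : ℝ) : a < 5 → 5 ≤ b → b < 5 + n → b % 2 = 0 → 0 < X / Px a →
      X / Px a < 1 → Y = 2 ^ (b - 5) * (1 - X / Px a) → Desc n a b X Y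
  | dn (a b : ℕ) (X Y : ℝ) : a < 5 → 5 ≤ b → b < 5 + n → b % 2 = 1 → 0 < X / Px a →
      X / Px a < 1 → -Y = 2 ^ (b - 5) * (1 - X / Px a) → Desc n a b X Y
  | xy (X Y : ℝ) : -1 < X → X < 2 → Y = min ((X + 1) / 8) ((2 - X) / 4) → Desc n 0 1 X Y
  | xz (X Y : ℝ) : -1 < X → X < 3 → Y = 2 ^ n * min (1 + X) (1 - X / 3) → Desc n 0 4 X Y
  | yz (X Y : ℝ) : -2 < X → X < 2 → -Y = 2 ^ n * (1 - |X| / 2) → Desc n 1 2 X Y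
  | ax (a b : ℕ) (X Y : ℝ) : ((a = 0 ∧ b = 2 ∧ -2 < X ∧ X < -1) ∨ (a = 0 ∧ b = 3 ∧ -1 < X ∧ X < 1)
      ∨ (a = 1 ∧ b = 3 ∧ 1 < X ∧ X < 2) ∨ (a = 1 ∧ b = 4 ∧ 2 < X ∧ X < 3)) → Y = 0 → Desc n a b X Y

theorem Py_lt {k : ℕ} (h : k < 5) : Py k = 0 := by
  unfold Py; rw [if_neg (by omega)]

theorem Py_ev {k : ℕ} (h : 5 ≤ k) (h' : k % 2 = 0) : Py k = 2 ^ (k - 5) := by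
  unfold Py; rw [if_pos h, if_pos h']

theorem Py_od {k : ℕ} (h : 5 ≤ k) (h' : k % 2 = 1) : Py k = -2 ^ (k - 5) := by
  unfold Py; rw [if_pos h, if_neg (by omega)]

theorem Px_ne {a : ℕ} (h : a < 5) : Px a ≠ 0 := by
  interval_cases a <;> simp only [Px0, Px1, Px2, Px3, Px4] <;> norm_num

theorem pos_eq {a b : ℕ} (h1 : Px a = Px b) (h2 : Py a = Py b) : a = b := by
  by_cases ha : 5 ≤ a
  · by_cases hb : 5 ≤ b
    · have e1 : |Py a| = 2 ^ (a - 5) := by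
        rcases Nat.mod_two_eq_zero_or_one a with h | h
        · rw [Py_ev ha h]; exact abs_of_pos (by positivity)
        · rw [Py_od ha h, abs_neg]; exact abs_of_pos (by positivity)
      have e2 : |Py b| = 2 ^ (b - 5) := by
        rcases Nat.mod_two_eq_zero_or_one b with h | h
        · rw [Py_ev hb h]; exact abs_of_pos (by positivity)
        · rw [Py_od hb h, abs_neg]; exact abs_of_pos (by positivity)
      rw [h2, e2] at e1
      have := pow_right_injective₀ (by norm_num : (0:ℝ) < 2) (by norm_num) e1
      omega
    · rw [Px5 ha] at h1
      exact absurd h1.symm (Px_ne (by omega))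
  · by_cases hb : 5 ≤ b
    · rw [Px5 hb] at h1
      exact absurd h1 (Px_ne (by omega))
    · push Not at ha hb
      interval_cases a <;> interval_cases b <;> first
        | rfl
        | (exfalso; simp only [Px0, Px1, Px2, Px3, Px4] at h1; linarith)

theorem strict_of {p q X : ℝ} (hpq : p < q) (hX : X ∈ Set.uIcc p q) (h1 : X ≠ p) (h2 : X ≠ q) :
    p < X ∧ X < q := by
  rw [Set.uIcc_of_le hpq.le] at hX
  exact ⟨lt_of_le_of_ne hX.1 h1.symm, lt_of_le_of_ne hX.2 h2⟩

theorem strict_of' {p q X : ℝ} (hpq : q < p) (hX : X ∈ Set.uIcc p q) (h1 : X ≠ p) (h2 : X ≠ q) :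
    q < X ∧ X < p := by
  rw [Set.uIcc_of_ge hpq.le] at hX
  exact ⟨lt_of_le_of_ne hX.1 h2.symm, lt_of_le_of_ne hX.2 h1⟩

theorem ratio_of {p X : ℝ} (hp : p ≠ 0) (hX : X ∈ Set.uIcc p 0) (h1 : X ≠ p) (h2 : X ≠ 0) :
    0 < X / p ∧ X / p < 1 := by
  rcases lt_or_gt_of_ne hp with h | h
  · obtain ⟨a, b⟩ := strict_of h hX h1 h2
    exact ⟨div_pos_of_neg_of_neg b h, (div_lt_one_of_neg h).2 a⟩
  · obtain ⟨a, b⟩ := strict_of' h hX h1 h2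
    exact ⟨div_pos a h, (div_lt_one h).2 b⟩

theorem desc_of {n a b : ℕ} (hab : a < b) (hb : b < 5 + n) (hc : cls a ≠ cls b) {X Y : ℝ}
    (hY : Y = fnL n a b X) (hX : X ∈ Set.uIcc (Px a) (Px b))
    (h1 : ¬ (X = Px a ∧ Y = Py a)) (h2 : ¬ (X = Px b ∧ Y = Py b)) : Desc n a b X Y := by
  by_cases hb5 : 5 ≤ b
  · have ha : a < 5 := by
      by_contra h; apply hc; unfold cls; split_ifs <;> omega
    have hp := Px_ne ha
    rw [fnL, if_pos hb5] at hY
    rw [Px5 hb5] at hX h2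
    have n1 : X ≠ Px a := by
      intro h; apply h1; refine ⟨h, ?_⟩
      rw [hY, h, div_self hp, Py_lt ha]; ring
    have n2 : X ≠ 0 := by
      intro h; apply h2; refine ⟨h, ?_⟩
      rw [hY, h]; ring
    obtain ⟨r1, r2⟩ := ratio_of hp hX n1 n2
    rcases Nat.mod_two_eq_zero_or_one b with h | h
    · rw [Py_ev hb5 h] at hY
      exact Desc.up a b X Y ha hb5 hb h r1 r2 hY
    · rw [Py_od hb5 h] at hY
      exact Desc.dn a b X Y ha hb5 hb h r1 r2 (by rw [hY]; ring)
  · push Not at hb5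
    rw [Py_lt (by omega)] at h1
    rw [Py_lt (by omega)] at h2
    clear hb
    interval_cases b
    · omega
    · obtain rfl : a = 0 := by omega
      simp [fnL] at hY
      rw [Px0, Px1] at *
      obtain ⟨q1, q2⟩ := strict_of (by norm_num) hX (by
        rintro rfl; apply h1; refine ⟨rfl, ?_⟩; rw [hY]; norm_num) (by
        rintro rfl; apply h2; refine ⟨rfl, ?_⟩; rw [hY]; norm_num)
      exact Desc.xy X Y q1 q2 hY
    · interval_cases a
      · simp [fnL] at hY
        rw [Px0, Px2] at *
        obtain ⟨q1, q2⟩ := strict_of' (by norm_num) hX (fun h => h1 ⟨h, hY⟩) (fun h => h2 ⟨h, hY⟩)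
        exact Desc.ax _ _ X Y (by simp [q1, q2]) hY
      · simp [fnL] at hY
        rw [Px1, Px2] at *
        obtain ⟨q1, q2⟩ := strict_of' (by norm_num) hX (by
          rintro rfl; apply h1; refine ⟨rfl, ?_⟩; rw [hY]; norm_num) (by
          rintro rfl; apply h2; refine ⟨rfl, ?_⟩; rw [hY]; norm_num)
        exact Desc.yz X Y q1 q2 (by rw [hY]; ring)
    · interval_cases a
      · simp [fnL] at hY
        rw [Px0, Px3] at *
        obtain ⟨q1, q2⟩ := strict_of (by norm_num) hX (fun h => h1 ⟨h, hY⟩) (fun h => h2 ⟨h, hY⟩)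
        exact Desc.ax _ _ X Y (by simp [q1, q2]) hY
      · simp [fnL] at hY
        rw [Px1, Px3] at *
        obtain ⟨q1, q2⟩ := strict_of' (by norm_num) hX (fun h => h1 ⟨h, hY⟩) (fun h => h2 ⟨h, hY⟩)
        exact Desc.ax _ _ X Y (by simp [q1, q2]) hY
      · exact absurd rfl hc
    · interval_cases a
      · simp [fnL] at hY
        rw [Px0, Px4] at *
        obtain ⟨q1, q2⟩ := strict_of (by norm_num) hX (by
          rintro rfl; apply h1; refine ⟨rfl, ?_⟩; rw [hY]; norm_num) (by
          rintro rfl; apply h2; refine ⟨rfl, ?_⟩; rw [hY]; norm_num)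
        exact Desc.xz X Y q1 q2 hY
      · simp [fnL] at hY
        rw [Px1, Px4] at *
        obtain ⟨q1, q2⟩ := strict_of (by norm_num) hX (fun h => h1 ⟨h, hY⟩) (fun h => h2 ⟨h, hY⟩)
        exact Desc.ax _ _ X Y (by simp [q1, q2]) hY
      · exact absurd rfl hc
      · exact absurd rfl hc

theorem up_pos {k : ℕ} {r Y : ℝ} (h : r < 1) (e : Y = 2 ^ k * (1 - r)) : 0 < Y := by
  rw [e]; exact mul_pos (by positivity) (by linarith)

theorem xy_pos {X Y : ℝ} (h1 : -1 < X) (h2 : X < 2) (e : Y = min ((X + 1) / 8) ((2 - X) / 4)) :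
    0 < Y := by
  rw [e]; exact lt_min (by linarith) (by linarith)

theorem xz_pos {n : ℕ} {X Y : ℝ} (h1 : -1 < X) (h2 : X < 3)
    (e : Y = 2 ^ n * min (1 + X) (1 - X / 3)) : 0 < Y := by
  rw [e]; exact mul_pos (by positivity) (lt_min (by linarith) (by linarith))

theorem yz_pos {n : ℕ} {X Y : ℝ} (h1 : -2 < X) (h2 : X < 2)
    (e : Y = 2 ^ n * (1 - |X| / 2)) : 0 < Y := by
  have := abs_lt.2 ⟨h1, h2⟩
  rw [e]; exact mul_pos (by positivity) (by linarith)

theorem desc_avoid {n a b c : ℕ} (hc : c < 5 + n) (h : Desc n a b (Px c) (Py c)) : False := by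
  by_cases h5 : 5 ≤ c
  · have hx := Px5 h5
    have hl : c - 5 < n := by omega
    have hlt : (2:ℝ) ^ (c - 5) < 2 ^ n := pow_lt_pow_right₀ (by norm_num) hl
    have hge : (1:ℝ) ≤ 2 ^ (c - 5) := one_le_pow₀ (by norm_num)
    have hy : Py c = 2 ^ (c - 5) ∨ Py c = -2 ^ (c - 5) := by
      rcases Nat.mod_two_eq_zero_or_one c with h | h
      · left; exact Py_ev h5 h
      · right; exact Py_od h5 h
    rw [hx] at h
    cases h with
    | up _ _ _ _ _ _ _ _ h => simp at h
    | dn _ _ _ _ _ _ _ _ h => simp at h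
    | xy _ _ _ _ e => norm_num at e; rcases hy with hy | hy <;> linarith
    | xz _ _ _ _ e => norm_num at e; rcases hy with hy | hy <;> linarith
    | yz _ _ _ _ e => norm_num at e; rcases hy with hy | hy <;> linarith
    | ax _ _ _ _ _ e => rcases hy with hy | hy <;> linarith
  · push Not at h5
    rw [Py_lt h5] at h
    cases h with
    | up _ _ _ _ _ _ _ _ _ h e => exact absurd (up_pos h e) (lt_irrefl _)
    | dn _ _ _ _ _ _ _ _ _ h e => have := up_pos h e; linarith
    | xy _ _ h1 h2 e => exact absurd (xy_pos h1 h2 e) (lt_irrefl _)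
    | xz _ _ h1 h2 e => exact absurd (xz_pos h1 h2 e) (lt_irrefl _)
    | yz _ _ h1 h2 e => have := yz_pos h1 h2 e; linarith
    | ax _ _ _ _ h _ =>
      interval_cases c <;> simp only [Px0, Px1, Px2, Px3, Px4] at h <;> norm_num at h
end UpperGeometry2

section UpperGeometry3

/-- The crossings that occur in the drawing. -/
inductive CC (n : ℕ) : ℕ → ℕ → ℕ → ℕ → ℝ → Prop
  | tt (a b c d : ℕ) (X : ℝ) : a < 5 → c < 5 → 5 ≤ b → b < d → d < 5 + n → b % 2 = d % 2 →
      ok4 a c → (a = 4 → c = 1 → 3 / 2 ≤ X) →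
      (2:ℝ) ^ (b - 5) * (1 - X / Px a) = 2 ^ (d - 5) * (1 - X / Px c) → CC n a b c d X
  | xy (d : ℕ) (X : ℝ) : 5 ≤ d → d < 5 + n → d % 2 = 0 →
      (2:ℝ) ^ (d - 5) * (1 - X / Px 3) = (X + 1) / 8 → CC n 0 1 3 d X
  | xz (d : ℕ) (X : ℝ) : 5 ≤ d → d < 5 + n → d % 2 = 0 →
      (2:ℝ) ^ (d - 5) * (1 - X / Px 2) = 2 ^ n * (1 + X) → CC n 0 4 2 d X
  | yz (d : ℕ) (X : ℝ) : 5 ≤ d → d < 5 + n → d % 2 = 1 →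
      (2:ℝ) ^ (d - 5) * (1 - X / Px 4) = 2 ^ n * (1 - X / 2) → CC n 1 2 4 d X

theorem two_pow_le {i j : ℕ} (h : i < j) : 2 * (2:ℝ) ^ i ≤ 2 ^ j := by
  have := pow_le_pow_right₀ (by norm_num : (1:ℝ) ≤ 2) (Nat.succ_le_of_lt h)
  rw [pow_succ] at this; linarith

theorem tt_pair {n a b c d : ℕ} {X Y : ℝ} (ha : a < 5) (hb : 5 ≤ b) (hbn : b < 5 + n)
    (h1 : 0 < X / Px a) (h2 : X / Px a < 1) (e : Y = 2 ^ (b - 5) * (1 - X / Px a))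
    (hc : c < 5) (hd : 5 ≤ d) (hdn : d < 5 + n) (hbd : b % 2 = d % 2)
    (h3 : 0 < X / Px c) (h4 : X / Px c < 1) (e' : Y = 2 ^ (d - 5) * (1 - X / Px c))
    (hne : ¬ (a = c ∧ b = d)) : CC n a b c d X ∨ CC n c d a b X := by
  rw [e] at e'
  rcases lt_trichotomy b d with h | h | h
  · left
    obtain ⟨r1, r2⟩ := TT_lt ha hc (by positivity) (two_pow_le (by omega : b - 5 < d - 5))
      h1 h2 h3 h4 e'
    exact CC.tt a b c d X ha hc hb h hdn hbd r1 r2 e'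
  · subst h
    exact absurd ⟨TT_same ha hc (by positivity) h1 e', rfl⟩ hne
  · right
    obtain ⟨r1, r2⟩ := TT_lt hc ha (by positivity) (two_pow_le (by omega : d - 5 < b - 5))
      h3 h4 h1 h2 e'.symm
    exact CC.tt c d a b X hc ha hd h hbn hbd.symm r1 r2 e'.symm

theorem pair_cc {n a b c d : ℕ} {X Y : ℝ} (h : Desc n a b X Y) (h' : Desc n c d X Y)
    (hne : ¬ (a = c ∧ b = d)) : CC n a b c d X ∨ CC n c d a b X := by
  have hH : (1:ℝ) ≤ 2 ^ n := one_le_pow₀ (by norm_num)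
  have hu : ∀ k, (1:ℝ) ≤ 2 ^ k := fun k => one_le_pow₀ (by norm_num)
  have hup : ∀ k, (0:ℝ) < 2 ^ k := fun k => by positivity
  cases h with
  | up _ _ _ _ ha hb hbn hev h1 h2 e =>
    have p1 := up_pos h2 e
    cases h' with
    | up _ _ _ _ hc hd hdn hev' h3 h4 e' =>
      exact tt_pair ha hb hbn h1 h2 e hc hd hdn (by omega) h3 h4 e' hne
    | dn _ _ _ _ _ _ _ _ _ h e' => have := up_pos h e'; exfalso; linarith
    | xy _ _ h3 h4 e' =>
      right
      rw [e] at e'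
      obtain ⟨rfl, r⟩ := T_xy ha (hu _) h1 h2 h3 h4 e'
      exact CC.xy _ _ hb hbn hev r
    | xz _ _ h3 h4 e' =>
      right
      rw [e] at e'
      obtain ⟨rfl, r⟩ := T_xz ha (hup _) (two_pow_le (by omega)) h1 h2 h3 h4 e'
      exact CC.xz _ _ hb hbn hev r
    | yz _ _ h3 h4 e' => have := yz_pos h3 h4 e'; exfalso; linarith
    | ax _ _ _ _ _ e' => exfalso; linarith
  | dn _ _ _ _ ha hb hbn hev h1 h2 e =>
    have p1 := up_pos h2 e
    cases h' with
    | dn _ _ _ _ hc hd hdn hev' h3 h4 e' =>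
      exact tt_pair ha hb hbn h1 h2 e hc hd hdn (by omega) h3 h4 e' hne
    | up _ _ _ _ _ _ _ _ _ h e' => have := up_pos h e'; exfalso; linarith
    | xy _ _ h3 h4 e' => have := xy_pos h3 h4 e'; exfalso; linarith
    | xz _ _ h3 h4 e' => have := xz_pos h3 h4 e'; exfalso; linarith
    | yz _ _ h3 h4 e' =>
      right
      rw [e] at e'
      obtain ⟨rfl, r⟩ := T_yz ha (hup _) (two_pow_le (by omega)) h1 h2 h3 h4 e'
      exact CC.yz _ _ hb hbn hev r
    | ax _ _ _ _ _ e' => exfalso; linarith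
  | xy _ _ h3 h4 e =>
    have p1 := xy_pos h3 h4 e
    cases h' with
    | up _ _ _ _ ha hb hbn hev h1 h2 e' =>
      left
      rw [e'] at e
      obtain ⟨rfl, r⟩ := T_xy ha (hu _) h1 h2 h3 h4 e
      exact CC.xy _ _ hb hbn hev r
    | dn _ _ _ _ _ _ _ _ _ h e' => have := up_pos h e'; exfalso; linarith
    | xy _ _ _ _ e' => exact absurd ⟨rfl, rfl⟩ hne
    | xz _ _ _ _ e' => rw [e] at e'; exact (xy_xz hH h3 h4 e').elim
    | yz _ _ h3 h4 e' => have := yz_pos h3 h4 e'; exfalso; linarith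
    | ax _ _ _ _ _ e' => exfalso; linarith
  | xz _ _ h3 h4 e =>
    have p1 := xz_pos h3 h4 e
    cases h' with
    | up _ _ _ _ ha hb hbn hev h1 h2 e' =>
      left
      rw [e'] at e
      obtain ⟨rfl, r⟩ := T_xz ha (hup _) (two_pow_le (by omega)) h1 h2 h3 h4 e
      exact CC.xz _ _ hb hbn hev r
    | dn _ _ _ _ _ _ _ _ _ h e' => have := up_pos h e'; exfalso; linarith
    | xy _ _ h5 h6 e' => rw [e'] at e; exact (xy_xz hH h5 h6 e).elim
    | xz _ _ _ _ e' => exact absurd ⟨rfl, rfl⟩ hne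
    | yz _ _ h3 h4 e' => have := yz_pos h3 h4 e'; exfalso; linarith
    | ax _ _ _ _ _ e' => exfalso; linarith
  | yz _ _ h3 h4 e =>
    have p1 := yz_pos h3 h4 e
    cases h' with
    | dn _ _ _ _ ha hb hbn hev h1 h2 e' =>
      left
      rw [e'] at e
      obtain ⟨rfl, r⟩ := T_yz ha (hup _) (two_pow_le (by omega)) h1 h2 h3 h4 e
      exact CC.yz _ _ hb hbn hev r
    | up _ _ _ _ _ _ _ _ _ h e' => have := up_pos h e'; exfalso; linarith
    | xy _ _ h3 h4 e' => have := xy_pos h3 h4 e'; exfalso; linarith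
    | xz _ _ h3 h4 e' => have := xz_pos h3 h4 e'; exfalso; linarith
    | yz _ _ _ _ e' => exact absurd ⟨rfl, rfl⟩ hne
    | ax _ _ _ _ _ e' => exfalso; linarith
  | ax _ _ _ _ h e =>
    cases h' with
    | dn _ _ _ _ _ _ _ _ _ h e' => have := up_pos h e'; exfalso; linarith
    | up _ _ _ _ _ _ _ _ _ h e' => have := up_pos h e'; exfalso; linarith
    | xy _ _ h3 h4 e' => have := xy_pos h3 h4 e'; exfalso; linarith
    | xz _ _ h3 h4 e' => have := xz_pos h3 h4 e'; exfalso; linarith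
    | yz _ _ h3 h4 e' => have := yz_pos h3 h4 e'; exfalso; linarith
    | ax _ _ _ _ h' e' =>
      exfalso
      rcases h with ⟨q1, q2, q3, q4⟩ | ⟨q1, q2, q3, q4⟩ | ⟨q1, q2, q3, q4⟩ | ⟨q1, q2, q3, q4⟩ <;>
      rcases h' with ⟨r1, r2, r3, r4⟩ | ⟨r1, r2, r3, r4⟩ | ⟨r1, r2, r3, r4⟩ | ⟨r1, r2, r3, r4⟩ <;>
      first | linarith | exact hne ⟨q1.trans r1.symm, q2.trans r2.symm⟩

theorem cc_lt {n a b c d : ℕ} {X : ℝ} (h : CC n a b c d X) :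
    b < d ∧ a ≠ c ∧ a ≠ d ∧ b ≠ c := by
  cases h with
  | tt _ _ _ _ _ ha hc hb hbd _ _ ok => unfold ok4 at ok; omega
  | xy => omega
  | xz => omega
  | yz => omega

theorem lin_uniq {A B X X' : ℝ} (h : A = B * X) (h' : A = B * X') (hA : A ≠ 0) : X = X' := by
  have hB : B ≠ 0 := by rintro rfl; apply hA; rw [h]; ring
  exact mul_left_cancel₀ hB (h.symm.trans h')

theorem cc_uniq {n a b c d : ℕ} {X X' : ℝ} (h : CC n a b c d X) (h' : CC n a b c d X') :
    X = X' := by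
  have hu : ∀ k, (1:ℝ) ≤ 2 ^ k := fun k => one_le_pow₀ (by norm_num)
  cases h with
  | tt _ _ _ _ _ ha hc hb hbd _ _ ok _ e =>
    cases h' with
    | tt _ _ _ _ _ _ _ _ _ _ _ _ _ e' =>
      have h2 := two_pow_le (by omega : b - 5 < d - 5)
      have h3 := hu (b - 5)
      refine lin_uniq (A := 2 ^ (b - 5) - 2 ^ (d - 5)) (B := 2 ^ (b - 5) / Px a - 2 ^ (d - 5) / Px c)
        ?_ ?_ ?_
      · linear_combination e
      · linear_combination e'
      · intro h; linarith
    | xy => omega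
    | xz => omega
    | yz => omega
  | xy _ _ hd hdn _ e =>
    cases h' with
    | tt => omega
    | xy _ _ _ _ _ e' =>
      have h3 := hu (d - 5)
      refine lin_uniq (A := 2 ^ (d - 5) - 1 / 8) (B := 2 ^ (d - 5) / Px 3 + 1 / 8) ?_ ?_ ?_
      · linear_combination e
      · linear_combination e'
      · intro h; linarith
  | xz _ _ hd hdn _ e =>
    cases h' with
    | tt => omega
    | xz _ _ _ _ _ e' =>
      have h2 := two_pow_le (by omega : d - 5 < n)
      have h3 := hu (d - 5)
      refine lin_uniq (A := 2 ^ (d - 5) - 2 ^ n) (B := 2 ^ (d - 5) / Px 2 + 2 ^ n) ?_ ?_ ?_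
      · linear_combination e
      · linear_combination e'
      · intro h; linarith
  | yz _ _ hd hdn _ e =>
    cases h' with
    | tt => omega
    | yz _ _ _ _ _ e' =>
      have h2 := two_pow_le (by omega : d - 5 < n)
      have h3 := hu (d - 5)
      refine lin_uniq (A := 2 ^ (d - 5) - 2 ^ n) (B := 2 ^ (d - 5) / Px 4 - 2 ^ n / 2) ?_ ?_ ?_
      · linear_combination e
      · linear_combination e'
      · intro h; linarith

/-- A label of an edge, used to exclude triple crossings. -/
def lab (a b : ℕ) : ℕ :=
  if 5 ≤ b then a else if b = 1 then 5 else if b = 4 then 6 else 7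

/-- The possible labels of crossing edges. -/
def LR (p q : ℕ) : Prop := (p = 2 ∧ q = 0) ∨ (p = 1 ∧ q = 3) ∨ (p = 4 ∧ q = 3) ∨ (p = 4 ∧ q = 1) ∨
  (p = 5 ∧ q = 3) ∨ (p = 6 ∧ q = 2) ∨ (p = 7 ∧ q = 4)

theorem cc_lab {n a b c d : ℕ} {X : ℝ} (h : CC n a b c d X) :
    LR (lab a b) (lab c d) ∧ (lab a b = 4 → lab c d = 1 → 3 / 2 ≤ X) := by
  cases h with
  | tt _ _ _ _ _ ha hc hb hbd _ _ ok hx =>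
    have e1 : lab a b = a := if_pos hb
    have e2 : lab c d = c := if_pos (by omega)
    rw [e1, e2]
    refine ⟨?_, hx⟩
    unfold ok4 at ok; unfold LR; omega
  | xy _ _ hd =>
    have e2 : lab 3 d = 3 := if_pos (by omega)
    rw [e2]
    exact ⟨by simp [LR, lab], by intro _ h; omega⟩
  | xz _ _ hd =>
    have e2 : lab 2 d = 2 := if_pos (by omega)
    rw [e2]
    exact ⟨by simp [LR, lab], by intro _ h; omega⟩
  | yz _ _ hd =>
    have e2 : lab 4 d = 4 := if_pos (by omega)
    rw [e2]
    exact ⟨by simp [LR, lab], by intro _ h; omega⟩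

theorem desc_lab {n a b : ℕ} {X Y : ℝ} (h : Desc n a b X Y) (hl : lab a b = 3) : X < 1 := by
  cases h with
  | up _ _ _ _ ha hb hbn hev h1 h2 e =>
    obtain rfl : a = 3 := by rw [lab, if_pos hb] at hl; exact hl
    rw [Px3] at h2; linarith
  | dn _ _ _ _ ha hb hbn hev h1 h2 e =>
    obtain rfl : a = 3 := by rw [lab, if_pos hb] at hl; exact hl
    rw [Px3] at h2; linarith
  | xy => simp [lab] at hl
  | xz => simp [lab] at hl
  | yz => simp [lab] at hl
  | ax _ _ _ _ h => exfalso; unfold lab at hl; split_ifs at hl <;> omega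

instance (p q : ℕ) : Decidable (LR p q) := by
  unfold LR; infer_instance

theorem lr_lt {p q : ℕ} (h : LR p q ∨ LR q p) : p < 8 ∧ q < 8 := by
  unfold LR at h; omega

set_option maxRecDepth 10000 in
theorem lab_triple' : ∀ p q r : Fin 8, (LR p q ∨ LR q p) ∧ (LR p r ∨ LR r p) ∧
    (LR q r ∨ LR r q) →
    (p = 3 ∧ q = 1 ∧ r = 4) ∨ (p = 3 ∧ q = 4 ∧ r = 1) ∨ (p = 1 ∧ q = 3 ∧ r = 4) ∨
      (p = 4 ∧ q = 3 ∧ r = 1) ∨ (p = 1 ∧ q = 4 ∧ r = 3) ∨ (p = 4 ∧ q = 1 ∧ r = 3) := by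
  decide

theorem lab_triple {p q r : ℕ} (h1 : LR p q ∨ LR q p) (h2 : LR p r ∨ LR r p)
    (h3 : LR q r ∨ LR r q) :
    (p = 3 ∧ q = 1 ∧ r = 4) ∨ (p = 3 ∧ q = 4 ∧ r = 1) ∨ (p = 1 ∧ q = 3 ∧ r = 4) ∨
      (p = 4 ∧ q = 3 ∧ r = 1) ∨ (p = 1 ∧ q = 4 ∧ r = 3) ∨ (p = 4 ∧ q = 1 ∧ r = 3) := by
  have := lab_triple' ⟨p, (lr_lt h1).1⟩ ⟨q, (lr_lt h1).2⟩ ⟨r, (lr_lt h2).2⟩ ⟨h1, h2, h3⟩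
  simpa [Fin.ext_iff] using this

theorem no_triple_cc {n a b c d e f : ℕ} {X Y : ℝ} (h1 : Desc n a b X Y) (h2 : Desc n c d X Y)
    (h3 : Desc n e f X Y) (n1 : ¬ (a = c ∧ b = d)) (n2 : ¬ (a = e ∧ b = f))
    (n3 : ¬ (c = e ∧ d = f)) : False := by
  have l1 := desc_lab h1
  have l2 := desc_lab h2
  have l3 := desc_lab h3
  have r : ∀ {a b c d : ℕ}, CC n a b c d X ∨ CC n c d a b X →
      (LR (lab a b) (lab c d) ∨ LR (lab c d) (lab a b)) ∧
      (lab a b = 4 → lab c d = 1 → 3 / 2 ≤ X) ∧ (lab a b = 1 → lab c d = 4 → 3 / 2 ≤ X) := by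
    intro a b c d h
    rcases h with h | h
    · obtain ⟨x, y⟩ := cc_lab h
      refine ⟨Or.inl x, y, ?_⟩
      intro u v; rw [u, v] at x; simp [LR] at x
    · obtain ⟨x, y⟩ := cc_lab h
      refine ⟨Or.inr x, ?_, fun u v => y v u⟩
      intro u v; rw [u, v] at x; simp [LR] at x
  obtain ⟨s1, t1, w1⟩ := r (pair_cc h1 h2 n1)
  obtain ⟨s2, t2, w2⟩ := r (pair_cc h1 h3 n2)
  obtain ⟨s3, t3, w3⟩ := r (pair_cc h2 h3 n3)
  generalize lab a b = p at *
  generalize lab c d = q at *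
  generalize lab e f = r at *
  have key : (p = 3 ∧ q = 1 ∧ r = 4) ∨ (p = 3 ∧ q = 4 ∧ r = 1) ∨ (p = 1 ∧ q = 3 ∧ r = 4) ∨
      (p = 4 ∧ q = 3 ∧ r = 1) ∨ (p = 1 ∧ q = 4 ∧ r = 3) ∨ (p = 4 ∧ q = 1 ∧ r = 3) := by
    exact lab_triple s1 s2 s3
  rcases key with ⟨k1, k2, k3⟩ | ⟨k1, k2, k3⟩ | ⟨k1, k2, k3⟩ | ⟨k1, k2, k3⟩ | ⟨k1, k2, k3⟩ |
    ⟨k1, k2, k3⟩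
  · linarith [l1 k1, w3 k2 k3]
  · linarith [l1 k1, t3 k2 k3]
  · linarith [l2 k2, w2 k1 k3]
  · linarith [l2 k2, t2 k1 k3]
  · linarith [l3 k3, w1 k1 k2]
  · linarith [l3 k3, t1 k1 k2]
end UpperGeometry3

section UpperDrawing

theorem Px_ne_of {a b : ℕ} (h : cls a ≠ cls b) : Px a ≠ Px b := by
  intro he
  by_cases ha : 5 ≤ a
  · by_cases hb : 5 ≤ b
    · apply h; unfold cls; split_ifs <;> omega
    · rw [Px5 ha] at he
      exact Px_ne (by omega) he.symm
  · by_cases hb : 5 ≤ b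
    · rw [Px5 hb] at he
      exact Px_ne (by omega) he
    · apply h
      rw [pos_eq he (by rw [Py_lt (by omega), Py_lt (by omega)])]

theorem fnL_ends {n a b : ℕ} (hab : a < b) (hc : cls a ≠ cls b) :
    fnL n a b (Px a) = Py a ∧ fnL n a b (Px b) = Py b := by
  by_cases hb5 : 5 ≤ b
  · have ha : a < 5 := by
      by_contra h; apply hc; unfold cls; split_ifs <;> omega
    simp only [fnL, if_pos hb5]
    rw [div_self (Px_ne ha), Px5 hb5, Py_lt ha]
    constructor <;> ring
  · push Not at hb5
    rw [Py_lt (by omega), Py_lt (by omega)]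
    interval_cases b <;> interval_cases a <;> first
      | exact absurd rfl hc
      | (simp only [fnL, Px0, Px1, Px2, Px3, Px4]; norm_num)

theorem fnL_cont (n a b : ℕ) : Continuous (fnL n a b) := by
  unfold fnL
  split_ifs <;> fun_prop

/-- The arc between the ranks `a` and `b`. -/
noncomputable def arcR (n a b : ℕ) (t : ℝ) : ℝ × ℝ :=
  (Px a + t * (Px b - Px a), fnL n (min a b) (max a b) (Px a + t * (Px b - Px a)))

theorem arcR_ends {n a b : ℕ} (hc : cls a ≠ cls b) :
    arcR n a b 0 = (Px a, Py a) ∧ arcR n a b 1 = (Px b, Py b) := by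
  have hne : a ≠ b := by rintro rfl; exact hc rfl
  unfold arcR
  have e0 : Px a + 0 * (Px b - Px a) = Px a := by ring
  have e1 : Px a + 1 * (Px b - Px a) = Px b := by ring
  rw [e0, e1]
  rcases lt_or_gt_of_ne hne with h | h
  · rw [min_eq_left h.le, max_eq_right h.le, (fnL_ends h hc).1, (fnL_ends h hc).2]
    exact ⟨rfl, rfl⟩
  · rw [min_eq_right h.le, max_eq_left h.le, (fnL_ends h hc.symm).1, (fnL_ends h hc.symm).2]
    exact ⟨rfl, rfl⟩

theorem arcR_symm (n a b : ℕ) (t : ℝ) : arcR n b a t = arcR n a b (1 - t) := by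
  unfold arcR
  have e : Px b + t * (Px a - Px b) = Px a + (1 - t) * (Px b - Px a) := by ring
  rw [e, min_comm, max_comm]

theorem arcR_mem {n a b : ℕ} (hab : a < b) {p : ℝ × ℝ} (h : p ∈ arcR n a b '' Set.Icc 0 1) :
    p.1 ∈ Set.uIcc (Px a) (Px b) ∧ p.2 = fnL n a b p.1 := by
  obtain ⟨t, ht, rfl⟩ := h
  refine ⟨?_, ?_⟩
  · show Px a + t * (Px b - Px a) ∈ _
    rw [← segment_eq_uIcc]
    exact ⟨1 - t, t, by linarith [ht.2], ht.1, by ring, by simp only [smul_eq_mul]; ring⟩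
  · show fnL n (min a b) (max a b) _ = _
    rw [min_eq_left hab.le, max_eq_right hab.le]
    rfl

theorem arcR_image (n a b : ℕ) : arcR n b a '' Set.Icc 0 1 = arcR n a b '' Set.Icc 0 1 := by
  ext p
  constructor
  · rintro ⟨t, ht, rfl⟩
    exact ⟨1 - t, ⟨by linarith [ht.2], by linarith [ht.1]⟩, (arcR_symm n a b t).symm⟩
  · rintro ⟨t, ht, rfl⟩
    exact ⟨1 - t, ⟨by linarith [ht.2], by linarith [ht.1]⟩, (arcR_symm n b a t).symm⟩

theorem arcR_avoid {n a b c : ℕ} (hc : cls a ≠ cls b) (ha : a < 5 + n) (hb : b < 5 + n)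
    (hcn : c < 5 + n) (hca : c ≠ a)
    (hcb : c ≠ b) : (Px c, Py c) ∉ arcR n a b '' Set.Icc 0 1 := by
  have main : ∀ {a b : ℕ}, a < b → cls a ≠ cls b → b < 5 + n → c ≠ a → c ≠ b →
      (Px c, Py c) ∉ arcR n a b '' Set.Icc 0 1 := by
    intro a b hab hc hb hca hcb h
    obtain ⟨h1, h2⟩ := arcR_mem hab h
    exact desc_avoid hcn (desc_of hab hb hc h2 h1 (fun h => hca (pos_eq h.1 h.2))
      (fun h => hcb (pos_eq h.1 h.2)))
  have hne : a ≠ b := by rintro rfl; exact hc rfl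
  rcases lt_or_gt_of_ne hne with h | h
  · exact main h hc hb hca hcb
  · rw [← arcR_image]; exact main h hc.symm ha hcb hca

/-- The optimal drawing. -/
noncomputable def DD (n : ℕ) : Drawing (quadK 1 1 3 n) where
  pos v := (Px (rk v), Py (rk v))
  pos_inj := fun v w h => rk_inj (pos_eq (Prod.ext_iff.1 h).1 (Prod.ext_iff.1 h).2)
  arc v w := arcR n (rk v) (rk w)
  arc_cont := by
    intro a b _
    have := fnL_cont n (min (rk a) (rk b)) (max (rk a) (rk b))
    apply Continuous.continuousOn
    unfold arcR
    fun_prop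
  arc_zero := fun a b h => (arcR_ends ((adj_rk a b).1 h)).1
  arc_one := fun a b h => (arcR_ends ((adj_rk a b).1 h)).2
  arc_symm := fun a b _ t => arcR_symm n (rk a) (rk b) t
  arc_avoid := fun a b h c h1 h2 => arcR_avoid ((adj_rk a b).1 h) (rk_lt a) (rk_lt b) (rk_lt c)
    (fun e => h1 (rk_inj e)) (fun e => h2 (rk_inj e))

theorem edge_desc {n : ℕ} {e : Sym2 (VV n)} {p : ℝ × ℝ} (h : p ∈ (DD n).edgePoints e)
    (h' : p ∉ (DD n).ends e) : ∃ v w, e = s(v, w) ∧ rk v < rk w ∧ Desc n (rk v) (rk w) p.1 p.2 ∧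
      p.2 = fnL n (rk v) (rk w) p.1 := by
  have main : ∀ {a b : VV n}, e = s(a, b) → (quadK 1 1 3 n).Adj a b → rk a < rk b →
      p ∈ arcR n (rk a) (rk b) '' Set.Icc 0 1 →
      ∃ v w, e = s(v, w) ∧ rk v < rk w ∧ Desc n (rk v) (rk w) p.1 p.2 ∧
      p.2 = fnL n (rk v) (rk w) p.1 := by
    intro a b he hadj hlt hp
    obtain ⟨h1, h2⟩ := arcR_mem hlt hp
    refine ⟨a, b, he, hlt, desc_of hlt (rk_lt b) ((adj_rk a b).1 hadj) h2 h1 ?_ ?_, h2⟩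
    · rintro ⟨x1, x2⟩
      exact h' ⟨a, by rw [he]; simp, Prod.ext x1 x2⟩
    · rintro ⟨x1, x2⟩
      exact h' ⟨b, by rw [he]; simp, Prod.ext x1 x2⟩
  obtain ⟨a, b, he, hadj, hp⟩ := h
  have hne : rk a ≠ rk b := fun h => (adj_rk a b).1 hadj (by rw [h])
  rcases lt_or_gt_of_ne hne with h | h
  · exact main he hadj h hp
  · refine main (a := b) (b := a) (by rw [he, Sym2.eq_swap]) hadj.symm h ?_
    rw [← arcR_image]; exact hp

theorem cross_cc {n : ℕ} {e f : Sym2 (VV n)} {p : ℝ × ℝ} (h : (DD n).IsCrossing e f p) :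
    ∃ v w v' w', e = s(v, w) ∧ rk v < rk w ∧ f = s(v', w') ∧ rk v' < rk w' ∧
      p.2 = fnL n (rk v) (rk w) p.1 ∧
      (CC n (rk v) (rk w) (rk v') (rk w') p.1 ∨ CC n (rk v') (rk w') (rk v) (rk w) p.1) := by
  obtain ⟨_, _, hne, h1, h2, h3, h4⟩ := h
  obtain ⟨v, w, e1, l1, d1, y1⟩ := edge_desc h1 h3
  obtain ⟨v', w', e2, l2, d2, y2⟩ := edge_desc h2 h4
  refine ⟨v, w, v', w', e1, l1, e2, l2, y1, pair_cc d1 d2 ?_⟩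
  rintro ⟨x1, x2⟩
  apply hne
  rw [e1, e2, rk_inj x1, rk_inj x2]

theorem sym_eq {n : ℕ} {v w v' w' : VV n} (h : s(v, w) = s(v', w')) (h1 : rk v < rk w)
    (h2 : rk v' < rk w') : v = v' ∧ w = w' := by
  rw [Sym2.eq_iff] at h
  rcases h with h | ⟨rfl, rfl⟩
  · exact h
  · omega

theorem DD_good (n : ℕ) : (DD n).IsGood where
  arc_inj := by
    intro a b h t _ t' _ he
    have h1 := Px_ne_of ((adj_rk a b).1 h)
    have h2 : Px (rk a) + t * (Px (rk b) - Px (rk a)) = Px (rk a) + t' * (Px (rk b) - Px (rk a)) :=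
      (Prod.ext_iff.1 he).1
    exact mul_right_cancel₀ (sub_ne_zero.2 h1.symm) (by linarith)
  adj_no_cross := by
    rintro e f ⟨a, he, hf⟩ p hc
    obtain ⟨v, w, v', w', rfl, l1, rfl, l2, _, hcc⟩ := cross_cc hc
    have k : rk v ≠ rk v' ∧ rk v ≠ rk w' ∧ rk w ≠ rk v' ∧ rk w ≠ rk w' := by
      rcases hcc with h | h <;> have := cc_lt h <;> omega
    rw [Sym2.mem_iff] at he hf
    rcases he with rfl | rfl <;> rcases hf with rfl | rfl <;> omega
  cross_once := by
    intro e f p hp p' hp'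
    obtain ⟨v, w, v', w', rfl, l1, rfl, l2, y, hcc⟩ := cross_cc hp
    obtain ⟨v2, w2, v2', w2', e1, l1', e2, l2', y', hcc'⟩ := cross_cc hp'
    obtain ⟨rfl, rfl⟩ := sym_eq e1 l1 l1'
    obtain ⟨rfl, rfl⟩ := sym_eq e2 l2 l2'
    have hx : p.1 = p'.1 := by
      rcases hcc with h | h <;> rcases hcc' with h' | h'
      · exact cc_uniq h h'
      · have := cc_lt h; have := cc_lt h'; omega
      · have := cc_lt h; have := cc_lt h'; omega
      · exact cc_uniq h h'
    exact Prod.ext hx (by rw [y, y', hx])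
  no_triple := by
    rintro p e f g h1 h2 h3 ⟨c1, c2, _⟩
    obtain ⟨v, w, e1, l1, d1, _⟩ := edge_desc c1.2.2.2.1 c1.2.2.2.2.2.1
    obtain ⟨v', w', e2, l2, d2, _⟩ := edge_desc c2.2.2.2.1 c2.2.2.2.2.2.1
    obtain ⟨v'', w'', e3, l3, d3, _⟩ := edge_desc c2.2.2.2.2.1 c2.2.2.2.2.2.2
    refine no_triple_cc d1 d2 d3 ?_ ?_ ?_
    · rintro ⟨x1, x2⟩; apply h1; rw [e1, e2, rk_inj x1, rk_inj x2]
    · rintro ⟨x1, x2⟩; apply h2; rw [e1, e3, rk_inj x1, rk_inj x2]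
    · rintro ⟨x1, x2⟩; apply h3; rw [e2, e3, rk_inj x1, rk_inj x2]

/-- The pair of edges with given ranks of the ends. -/
def ev (n a b c d : ℕ) : Sym2 (Sym2 (VV n)) := s(s(vx n a, vx n b), s(vx n c, vx n d))

/-- Allowed ends. -/
def Q4 : Finset (ℕ × ℕ) := {(2, 0), (1, 3), (4, 3), (4, 1)}

open Classical in
/-- Crossings in which the highest vertex is `j`. -/
noncomputable def LLj (n j : ℕ) : Finset (Sym2 (Sym2 (VV n))) :=
  (Finset.range (j / 2) ×ˢ Q4).image (fun q => ev n q.2.1 (5 + j - 2 * (q.1 + 1)) q.2.2 (5 + j)) ∪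
    (if j % 2 = 1 then {ev n 0 1 3 (5 + j), ev n 0 4 2 (5 + j)} else {ev n 1 2 4 (5 + j)})

open Classical in
/-- All crossings of the drawing. -/
noncomputable def LL (n : ℕ) : Finset (Sym2 (Sym2 (VV n))) := (Finset.range n).biUnion (LLj n)

theorem cc_mem {n a b c d : ℕ} {X : ℝ} (h : CC n a b c d X) : ev n a b c d ∈ LL n := by
  classical
  have key : ∀ d, 5 ≤ d → d < 5 + n → ∀ q, q ∈ LLj n (d - 5) → q ∈ LL n := by
    intro d h1 h2 q hq
    exact Finset.mem_biUnion.2 ⟨d - 5, Finset.mem_range.2 (by omega), hq⟩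
  cases h with
  | tt _ _ _ _ _ ha hc hb hbd hdn hpar ok =>
    apply key d (by omega) hdn
    apply Finset.mem_union_left
    refine Finset.mem_image.2 ⟨((d - b) / 2 - 1, (a, c)), ?_, ?_⟩
    · refine Finset.mem_product.2 ⟨Finset.mem_range.2 ?_, ?_⟩
      · dsimp only; omega
      · simp only [Q4, Finset.mem_insert, Finset.mem_singleton, Prod.mk.injEq]
        exact ok
    · dsimp only
      have e1 : 5 + (d - 5) = d := by omega
      have e2 : d - 2 * ((d - b) / 2 - 1 + 1) = b := by omega
      rw [e1, e2]
  | xy _ _ h5 hdn hpar =>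
    apply key d h5 hdn
    apply Finset.mem_union_right
    have e1 : 5 + (d - 5) = d := by omega
    rw [if_pos (by omega), e1]
    simp
  | xz _ _ h5 hdn hpar =>
    apply key d h5 hdn
    apply Finset.mem_union_right
    have e1 : 5 + (d - 5) = d := by omega
    rw [if_pos (by omega), e1]
    simp
  | yz _ _ h5 hdn hpar =>
    apply key d h5 hdn
    apply Finset.mem_union_right
    have e1 : 5 + (d - 5) = d := by omega
    rw [if_neg (by omega), e1]
    simp

theorem card_LLj (n j : ℕ) : (LLj n j).card ≤ 4 * (j / 2) + (1 + j % 2) := by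
  classical
  unfold LLj
  refine (Finset.card_union_le _ _).trans (add_le_add ?_ ?_)
  · refine Finset.card_image_le.trans ?_
    rw [Finset.card_product, Finset.card_range]
    have : Q4.card = 4 := rfl
    rw [this]; omega
  · split_ifs with h
    · rw [h]; exact Finset.card_le_two
    · simp

theorem sum_formula (n : ℕ) : ∑ j ∈ Finset.range (n + 1), (4 * (j / 2) + (1 + j % 2)) =
    Z 5 (n + 1) + 3 * (n + 1) / 2 := by
  have hZ : ∀ m, Z 5 m = 4 * ((m / 2) * ((m - 1) / 2)) := by
    intro m
    show 2 * 2 * (m / 2) * ((m - 1) / 2) = _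
    ring
  induction n with
  | zero => rfl
  | succ n ih =>
    rw [Finset.sum_range_succ, ih, hZ, hZ]
    rcases Nat.even_or_odd' n with ⟨k, rfl | rfl⟩
    · have e1 : (2 * k + 1) / 2 = k := by omega
      have e2 : (2 * k + 1 - 1) / 2 = k := by omega
      have e3 : (2 * k + 1 + 1) / 2 = k + 1 := by omega
      have e4 : (2 * k + 1 + 1 - 1) / 2 = k := by omega
      rw [e1, e2, e3, e4, add_mul]
      omega
    · have e1 : (2 * k + 1 + 1) / 2 = k + 1 := by omega
      have e2 : (2 * k + 1 + 1 - 1) / 2 = k := by omega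
      have e3 : (2 * k + 1 + 1 + 1) / 2 = k + 1 := by omega
      have e4 : (2 * k + 1 + 1 + 1 - 1) / 2 = k + 1 := by omega
      have e5 : (k + 1) * (k + 1) = (k + 1) * k + (k + 1) := by ring
      clear ih
      rw [e1, e2, e3, e4, e5]
      omega

theorem vx_rk {n : ℕ} (v : VV n) : vx n (rk v) = v := rk_inj (rk_vx (rk_lt v))

theorem upper_bound (n : ℕ) (hn : 0 < n) : (DD n).crNum ≤ Z 5 n + 3 * n / 2 := by
  classical
  have h1 : (DD n).crNum ≤ (LL n).card := by
    have := Set.ncard_le_ncard_of_injOn (s := (DD n).crossings (quadK 1 1 3 n).edgeSet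
      (quadK 1 1 3 n).edgeSet) (t := (LL n : Set _)) Prod.snd ?_
      (crossings_injOn (DD n) (DD_good n) _ _) (Finset.finite_toSet _)
    · rw [Set.ncard_coe_finset] at this
      exact this
    · rintro ⟨p, q⟩ ⟨e, f, hq, _, _, hc⟩
      dsimp only at hq hc ⊢
      obtain ⟨v, w, v', w', rfl, l1, rfl, l2, _, hcc⟩ := cross_cc hc
      rw [hq]
      rcases hcc with h | h
      · have := cc_mem h
        simpa only [ev, vx_rk, Finset.mem_coe] using this
      · have := cc_mem h
        rw [Sym2.eq_swap]
        simpa only [ev, vx_rk, Finset.mem_coe] using this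
  refine h1.trans (Finset.card_biUnion_le.trans ?_)
  obtain ⟨k, rfl⟩ : ∃ k, n = k + 1 := ⟨n - 1, by omega⟩
  rw [← sum_formula]
  exact Finset.sum_le_sum fun j _ => card_LLj _ j
end UpperDrawing

end CrK

/-- For every positive integer `n`, `cr(K_{1,1,3,n}) = Z(5,n) + ⌊3n/2⌋`. -/
theorem statement10 (n : ℕ) (hn : 0 < n) :
    crossingNumber (quadK 1 1 3 n) = Z 5 n + 3 * n / 2 := by
  unfold crossingNumber
  have hDD : (CrK.DD n).crNum = Z 5 n + 3 * n / 2 :=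
    le_antisymm (CrK.upper_bound n hn) (CrK.lower_bound n hn _ (CrK.DD_good n))
  apply le_antisymm
  · exact Nat.sInf_le ⟨CrK.DD n, CrK.DD_good n, hDD⟩
  · obtain ⟨D, hD, he⟩ := Nat.sInf_mem
      (s := {m | ∃ D : Drawing (quadK 1 1 3 n), D.IsGood ∧ D.crNum = m})
      ⟨_, CrK.DD n, CrK.DD_good n, rfl⟩
    rw [← he]
    exact CrK.lower_bound n hn D hD
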